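/- arXiv:1107.3869 — 5 statements merged into one kernel-verified Lean document; each statement's English description precedes it below -/
import Mathlib

section
/- Let X and Y be independent real random variables with P(X > u) ~ C_X u^γ exp(-K_X u^α) as u → ∞ (with C_X, K_X, α > 0, γ ∈ ℝ, α > 1), and suppose ess sup Y = σ ∈ ℝ with P(Y > u) ~ C_Y (σ - u)^μ as u ↑ σ (with C_Y, μ > 0). Then P(X + Y > u) ~ C_X C_Y (K_X α)^{-μ} Γ(μ+1) u^{μ + γ - α μ} exp(-K_X (u - σ)^α) as u → ∞. -/
open MeasureTheory ProbabilityTheory Filter Asymptotics Topology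

noncomputable def auxH (γ α ε t : ℝ) : ℝ :=
  (1 + ε * t) ^ γ * Real.exp (-(((1 + ε * t) ^ α - 1) / (α * ε)))

noncomputable def auxK (γ α ε t : ℝ) : ℝ :=
  auxH γ α ε t * ((1 + ε * t) ^ (α - 1) - γ * ε / (1 + ε * t))

lemma auxH_deriv (γ α ε t : ℝ) (hα : 1 < α) (hε : 0 < ε) (ht : 0 ≤ t) :
    HasDerivAt (auxH γ α ε) (-auxK γ α ε t) t := by
  have hs : 0 < 1 + ε * t := by positivity
  have h1 : HasDerivAt (fun t : ℝ => 1 + ε * t) ε t := by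
    simpa using ((hasDerivAt_id t).const_mul ε).const_add 1
  have h2 := h1.rpow_const (p := γ) (Or.inl hs.ne')
  have h3 := h1.rpow_const (p := α) (Or.inl hs.ne')
  have h4 := (((h3.sub_const 1).div_const (α * ε)).neg).exp
  have h5 := h2.mul h4
  refine h5.congr_deriv ?_
  unfold auxK auxH
  rw [Real.rpow_sub_one hs.ne' γ]
  have : α ≠ 0 := by positivity
  simp only [Pi.neg_apply]
  field_simp
  ring

lemma auxH_bound (γ α ε t : ℝ) (hα : 1 < α) (hε : 0 < ε) (hε1 : ε ≤ 1) (ht : 0 ≤ t) :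
    |auxH γ α ε t| ≤ (1 + t) ^ |γ| * Real.exp (-t) := by
  unfold auxH
  have hs : 1 ≤ 1 + ε * t := by have : 0 ≤ ε * t := by positivity
                                linarith
  have hst : 1 + ε * t ≤ 1 + t := by nlinarith
  rw [abs_of_nonneg (by positivity)]
  gcongr
  · calc (1 + ε * t) ^ γ ≤ (1 + ε * t) ^ |γ| :=
          Real.rpow_le_rpow_of_exponent_le hs (le_abs_self γ)
      _ ≤ _ := Real.rpow_le_rpow (by positivity) hst (abs_nonneg _)
  · rw [le_div_iff₀ (by positivity)]
    have := one_add_mul_self_le_rpow_one_add (s := ε * t) (by linarith) hα.le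
    linarith

lemma auxK_bound (γ α ε t : ℝ) (hα : 1 < α) (hε : 0 < ε) (hε1 : ε ≤ 1) (ht : 0 ≤ t) :
    |auxK γ α ε t| ≤ (1 + |γ|) * ((1 + t) ^ (|γ| + (α - 1)) * Real.exp (-t)) := by
  have hs : 1 ≤ 1 + ε * t := by have : 0 ≤ ε * t := by positivity
                                linarith
  have hst : 1 + ε * t ≤ 1 + t := by nlinarith
  have h1 := auxH_bound γ α ε t hα hε hε1 ht
  have h0 : 1 ≤ (1 + t) ^ (α - 1) := Real.one_le_rpow (by linarith) (by linarith)
  have h2 : |(1 + ε * t) ^ (α - 1) - γ * ε / (1 + ε * t)| ≤ (1 + |γ|) * (1 + t) ^ (α - 1) := by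
    refine (abs_sub _ _).trans ?_
    have a1 : |(1 + ε * t) ^ (α - 1)| ≤ (1 + t) ^ (α - 1) := by
      rw [abs_of_nonneg (by positivity)]
      exact Real.rpow_le_rpow (by positivity) hst (by linarith)
    have a2 : |γ * ε / (1 + ε * t)| ≤ |γ| := by
      rw [abs_div, abs_mul, abs_of_pos hε, abs_of_pos (by linarith : 0 < 1 + ε * t)]
      rw [div_le_iff₀ (by linarith)]
      have := abs_nonneg γ
      nlinarith
    have := abs_nonneg γ
    nlinarith
  unfold auxK
  rw [abs_mul, Real.rpow_add (by linarith)]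
  calc _ ≤ ((1 + t) ^ |γ| * Real.exp (-t)) * ((1 + |γ|) * (1 + t) ^ (α - 1)) := by gcongr
    _ = _ := by ring

lemma auxK_lim (γ α t : ℝ) (hα : 1 < α) :
    Tendsto (fun ε => auxK γ α ε t) (𝓝[>] 0) (𝓝 (Real.exp (-t))) := by
  have l0 : Tendsto (fun ε : ℝ => 1 + ε * t) (𝓝[>] 0) (𝓝 1) := by
    have : ContinuousAt (fun ε : ℝ => 1 + ε * t) 0 := by fun_prop
    simpa [ContinuousAt] using this.tendsto.mono_left nhdsWithin_le_nhds
  have lp : ∀ p : ℝ, Tendsto (fun ε : ℝ => (1 + ε * t) ^ p) (𝓝[>] 0) (𝓝 1) := by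
    intro p
    simpa using l0.rpow_const (p := p) (Or.inl one_ne_zero)
  have lε : Tendsto (fun ε : ℝ => ε) (𝓝[>] 0) (𝓝 0) := nhdsWithin_le_nhds
  have ld : Tendsto (fun ε : ℝ => γ * ε / (1 + ε * t)) (𝓝[>] 0) (𝓝 0) := by
    have h := (lε.const_mul γ).div l0 one_ne_zero
    rw [mul_zero, zero_div] at h
    exact h
  have lder : Tendsto (fun ε : ℝ => ((1 + ε * t) ^ α - 1) / (α * ε)) (𝓝[>] 0) (𝓝 t) := by
    have h1 : HasDerivAt (fun ε : ℝ => 1 + ε * t) t 0 := by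
      simpa using ((hasDerivAt_id (0:ℝ)).mul_const t).const_add 1
    have h3 := h1.rpow_const (p := α) (Or.inl (by simp))
    have h4 := h3.tendsto_slope_zero_right
    simp only [zero_add, zero_mul, add_zero, Real.one_rpow, mul_one, smul_eq_mul] at h4
    have h5 := h4.div_const α
    have ha : α ≠ 0 := by positivity
    rw [mul_div_cancel_right₀ _ ha] at h5
    refine h5.congr fun ε => ?_
    rw [div_eq_mul_inv, div_eq_mul_inv, mul_inv]; ring
  have := ((lp γ).mul ((Real.continuous_exp.tendsto _).comp lder.neg)).mul ((lp (α-1)).sub ld)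
  simpa [auxK, auxH, Function.comp_def] using this

lemma bound_integrable (N : ℝ) :
    IntegrableOn (fun t : ℝ => (1 + t) ^ N * Real.exp (-t)) (Set.Ioi 0) := by
  refine integrable_of_isBigO_exp_neg (b := 1/2) (by norm_num) ?_ ?_
  · intro t ht
    have : (1 + t) ≠ 0 := by have : (0:ℝ) ≤ t := ht
                             positivity
    refine ContinuousAt.continuousWithinAt ?_
    exact ((continuousAt_const.add continuousAt_id).rpow_const (Or.inl this)).mul
      (by fun_prop)
  · have h := isLittleO_rpow_exp_pos_mul_atTop N (b := 1/2) (by norm_num)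
    have h2 := h.comp_tendsto (tendsto_atTop_add_const_left atTop 1 tendsto_id)
    have h3 := (h2.isBigO.mul (isBigO_refl (fun t : ℝ => Real.exp (-t)) atTop))
    simp only [Function.comp_def, id] at h3
    refine h3.trans (IsBigO.of_bound (Real.exp (1/2)) (Eventually.of_forall fun t => ?_))
    rw [← Real.exp_add, Real.norm_eq_abs, Real.norm_eq_abs, Real.abs_exp, Real.abs_exp,
      ← Real.exp_add]
    apply le_of_eq; congr 1; ring

lemma auxH_lim (γ α ε : ℝ) (hα : 1 < α) (hε : 0 < ε) (hε1 : ε ≤ 1) :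
    Tendsto (auxH γ α ε) atTop (𝓝 0) := by
  have h := isLittleO_rpow_exp_pos_mul_atTop |γ| (b := 1) (by norm_num)
  have h2 := (h.comp_tendsto (tendsto_atTop_add_const_left atTop 1 tendsto_id)).tendsto_div_nhds_zero
  have h3 := h2.mul_const (Real.exp 1)
  rw [zero_mul] at h3
  refine squeeze_zero_norm' ?_ h3
  filter_upwards [eventually_ge_atTop 0] with t ht
  refine (auxH_bound γ α ε t hα hε hε1 ht).trans (le_of_eq ?_)
  simp only [Function.comp_def, id, one_mul, Real.exp_add, Real.exp_neg]
  field_simp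

lemma auxK_meas (γ α ε : ℝ) : Measurable (auxK γ α ε) := by
  unfold auxK auxH; fun_prop

lemma auxH_meas (γ α ε : ℝ) : Measurable (auxH γ α ε) := by
  unfold auxH; fun_prop

lemma auxK_int (γ α ε : ℝ) (hα : 1 < α) (hε : 0 < ε) (hε1 : ε ≤ 1) :
    IntegrableOn (auxK γ α ε) (Set.Ioi 0) := by
  refine Integrable.mono' ((bound_integrable (|γ| + (α - 1))).const_mul (1 + |γ|))
    (auxK_meas γ α ε).aestronglyMeasurable ?_
  filter_upwards [self_mem_ae_restrict measurableSet_Ioi] with t ht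
  exact auxK_bound γ α ε t hα hε hε1 (le_of_lt ht)

lemma layer {Ω : Type*} [MeasurableSpace Ω] (μ : Measure Ω) [IsProbabilityMeasure μ]
    (W : Ω → ℝ) (hW : Measurable W) (hW0 : ∀ᵐ ω ∂μ, 0 ≤ W ω) (h k : ℝ → ℝ)
    (hd : ∀ t, 0 ≤ t → HasDerivAt h (-k t) t) (hk : IntegrableOn k (Set.Ioi 0))
    (hl : Tendsto h atTop (𝓝 0)) :
    ∫ ω, h (W ω) ∂μ = ∫ t in Set.Ioi 0, k t * μ.real {ω | W ω < t} := by
  have e1 : ∀ᵐ ω ∂μ, h (W ω) = ∫ t in Set.Ioi 0, Set.indicator {t | W ω < t} k t := by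
    filter_upwards [hW0] with ω hω
    have : ∫ t in Set.Ioi (W ω), -k t = 0 - h (W ω) :=
      integral_Ioi_of_hasDerivAt_of_tendsto' (fun x hx => hd x (hω.trans hx))
        ((hk.mono_set (Set.Ioi_subset_Ioi hω)).neg) hl
    rw [integral_neg] at this
    have h2 : {t | W ω < t} = Set.Ioi (W ω) := rfl
    rw [h2, setIntegral_indicator measurableSet_Ioi, Set.Ioi_inter_Ioi, max_eq_right hω]
    linarith
  rw [integral_congr_ae e1, integral_integral_swap]
  · refine integral_congr_ae (Eventually.of_forall fun t => ?_)
    have : ∀ ω, Set.indicator {t | W ω < t} k t = Set.indicator {ω | W ω < t} (fun _ => k t) ω := by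
      intro ω; simp [Set.indicator]
    simp only [this]
    rw [integral_indicator_const _ (measurableSet_lt hW measurable_const)]
    simp [mul_comm]
  · have hm : MeasurableSet {p : Ω × ℝ | W p.1 < p.2} :=
      measurableSet_lt (hW.comp measurable_fst) measurable_snd
    have := (hk.comp_snd μ).indicator hm
    exact this

lemma scaled {Ω : Type*} [MeasurableSpace Ω] (μ : Measure Ω) [IsProbabilityMeasure μ]
    (Z : Ω → ℝ) (hZ : Measurable Z) (hZ0 : ∀ᵐ ω ∂μ, 0 < Z ω) (γ α CY mu : ℝ) (hα : 1 < α)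
    (hmu : 0 < mu) (hCY : 0 < CY)
    (hG : (fun z => μ.real {ω | Z ω < z}) ~[𝓝[>] 0] fun z => CY * z ^ mu)
    (b ε : ℝ → ℝ) (hb : Tendsto b atTop atTop) (hε : Tendsto ε atTop (𝓝[>] 0)) :
    Tendsto (fun v => b v ^ mu * ∫ ω, auxH γ α (ε v) (b v * Z ω) ∂μ) atTop
      (𝓝 (CY * Real.Gamma (mu + 1))) := by
  set G : ℝ → ℝ := fun z => μ.real {ω | Z ω < z} with hGdef
  have hGmeas : Measurable G := by
    have : Monotone G := fun x y hxy => measureReal_mono (fun ω (hω : Z ω < x) => lt_of_lt_of_le hω hxy)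
    exact this.measurable
  obtain ⟨C, hC0, hC⟩ : ∃ C, 0 ≤ C ∧ ∀ z, 0 < z → G z ≤ C * z ^ mu := by
    obtain ⟨c, hc, hcb⟩ := hG.isBigO.exists_pos
    have := hcb.bound
    obtain ⟨δ, hδ, hδb⟩ := (mem_nhdsGT_iff_exists_Ioo_subset).1 this
    have hδ : 0 < δ := hδ
    refine ⟨c * CY + 1 / δ ^ mu, by positivity, fun z hz => ?_⟩
    have hzp : 0 < z ^ mu := by positivity
    rcases lt_or_ge z δ with h | h
    · have h1 : ‖G z‖ ≤ c * ‖CY * z ^ mu‖ := hδb ⟨hz, h⟩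
      rw [Real.norm_of_nonneg (by positivity : 0 ≤ CY * z ^ mu)] at h1
      have h2 := (le_abs_self _).trans h1
      have : 0 ≤ 1 / δ ^ mu * z ^ mu := by positivity
      nlinarith
    · have h1 : G z ≤ 1 := measureReal_le_one
      have h2 : 1 ≤ 1 / δ ^ mu * z ^ mu := by
        rw [one_div, inv_mul_eq_div, le_div_iff₀ (by positivity), one_mul]
        exact Real.rpow_le_rpow hδ.le h hmu.le
      have : 0 ≤ c * CY * z ^ mu := by positivity
      nlinarith
  have hε0 : ∀ᶠ v in atTop, 0 < ε v := hε.eventually self_mem_nhdsWithin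
  have hε1 : ∀ᶠ v in atTop, ε v ≤ 1 :=
    (hε.mono_right nhdsWithin_le_nhds).eventually (eventually_le_nhds one_pos)
  have hb0 : ∀ᶠ v in atTop, 0 < b v := hb.eventually_gt_atTop 0
  have key : ∀ᶠ v in atTop, (∫ t in Set.Ioi 0, auxK γ α (ε v) t * (b v ^ mu * G (t / b v))) =
      b v ^ mu * ∫ ω, auxH γ α (ε v) (b v * Z ω) ∂μ := by
    filter_upwards [hε0, hε1, hb0] with v h0 h1 h2
    rw [layer μ (fun ω => b v * Z ω) (hZ.const_mul _)
      (by filter_upwards [hZ0] with ω hω using by positivity) _ (auxK γ α (ε v))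
      (fun t ht => auxH_deriv γ α _ t hα h0 ht) (auxK_int γ α _ hα h0 h1)
      (auxH_lim γ α _ hα h0 h1), ← integral_const_mul]
    refine integral_congr_ae (Eventually.of_forall fun t => ?_)
    have : {ω | b v * Z ω < t} = {ω | Z ω < t / b v} := by
      ext ω; simp only [Set.mem_ofPred_eq]; rw [lt_div_iff₀ h2, mul_comm]
    simp only [this, hGdef]; ring
  refine Tendsto.congr' key ?_
  have hlim : ∫ t in Set.Ioi 0, Real.exp (-t) * (CY * t ^ mu) = CY * Real.Gamma (mu + 1) := by
    rw [Real.Gamma_eq_integral (by positivity), ← integral_const_mul]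
    refine integral_congr_ae (Eventually.of_forall fun t => ?_)
    simp only [add_sub_cancel_right]; ring
  rw [← hlim]
  refine tendsto_integral_filter_of_dominated_convergence
    (fun t => (1 + |γ|) * C * ((1 + t) ^ (|γ| + (α - 1) + mu) * Real.exp (-t))) ?_ ?_ ?_ ?_
  · refine Eventually.of_forall fun v => ?_
    exact ((auxK_meas γ α (ε v)).mul
      ((hGmeas.comp (measurable_id.div_const _)).const_mul _)).aestronglyMeasurable
  · filter_upwards [hε0, hε1, hb0] with v h0 h1 h2
    filter_upwards [self_mem_ae_restrict measurableSet_Ioi] with t ht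
    have ht : 0 < t := ht
    rw [norm_mul]
    have k1 := auxK_bound γ α (ε v) t hα h0 h1 ht.le
    have k2 : ‖b v ^ mu * G (t / b v)‖ ≤ C * (1 + t) ^ mu := by
      have : 0 ≤ G (t / b v) := measureReal_nonneg
      rw [Real.norm_of_nonneg (by positivity)]
      calc b v ^ mu * G (t / b v) ≤ b v ^ mu * (C * (t / b v) ^ mu) := by
            gcongr; exact hC _ (by positivity)
        _ = C * t ^ mu := by
            rw [Real.div_rpow ht.le h2.le]
            have : 0 < b v ^ mu := by positivity
            field_simp
        _ ≤ _ := by gcongr; linarith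
    calc _ ≤ (1 + |γ|) * ((1 + t) ^ (|γ| + (α - 1)) * Real.exp (-t)) * (C * (1 + t) ^ mu) := by
          rw [Real.norm_eq_abs]; gcongr
      _ = _ := by rw [Real.rpow_add (by positivity) _ mu]; ring
  · exact (bound_integrable _).const_mul _
  · filter_upwards [self_mem_ae_restrict measurableSet_Ioi] with t ht
    have ht : 0 < t := ht
    refine ((auxK_lim γ α t hα).comp hε).mul ?_
    have hz : Tendsto (fun v => t / b v) atTop (𝓝[>] 0) := by
      refine tendsto_nhdsWithin_iff.2 ⟨hb.const_div_atTop t, ?_⟩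
      filter_upwards [hb0] with v h2
      exact div_pos ht h2
    have hq : Tendsto (fun z => G z / (CY * z ^ mu)) (𝓝[>] 0) (𝓝 1) := by
      refine (isEquivalent_iff_tendsto_one ?_).1 hG
      filter_upwards [self_mem_nhdsWithin] with z hz
      have hz : 0 < z := hz
      positivity
    have := (hq.comp hz).mul_const (CY * t ^ mu)
    rw [one_mul] at this
    refine this.congr' ?_
    filter_upwards [hb0] with v h2
    simp only [Function.comp_def]
    rw [Real.div_rpow ht.le h2.le]
    have : 0 < b v ^ mu := by positivity
    have : 0 < t ^ mu := by positivity
    field_simp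

lemma indep_tail {Ω : Type*} [MeasurableSpace Ω] (μ : Measure Ω) [IsProbabilityMeasure μ]
    (X Y : Ω → ℝ) (hXm : Measurable X) (hYm : Measurable Y) (hindep : IndepFun X Y μ) (u : ℝ) :
    μ.real {ω | X ω + Y ω > u} = ∫ ω, μ.real {ω' | X ω' > u - Y ω} ∂μ := by
  have hms : MeasurableSet {p : ℝ × ℝ | p.1 + p.2 > u} :=
    measurableSet_lt measurable_const (measurable_fst.add measurable_snd)
  have h1 := (indepFun_iff_map_prod_eq_prod_map_map hXm.aemeasurable hYm.aemeasurable).1 hindep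
  have : IsProbabilityMeasure (μ.map X) := Measure.isProbabilityMeasure_map hXm.aemeasurable
  have : IsProbabilityMeasure (μ.map Y) := Measure.isProbabilityMeasure_map hYm.aemeasurable
  have h2 : μ {ω | X ω + Y ω > u} = ∫⁻ ω, μ {ω' | X ω' > u - Y ω} ∂μ := by
    have : μ {ω | X ω + Y ω > u} = (μ.map fun ω => (X ω, Y ω)) {p : ℝ × ℝ | p.1 + p.2 > u} := by
      rw [Measure.map_apply (hXm.prodMk hYm) hms]; rfl
    rw [this, h1, Measure.prod_apply_symm hms, lintegral_map (measurable_measure_prodMk_right hms) hYm]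
    refine lintegral_congr fun ω => ?_
    rw [Measure.map_apply hXm (measurable_prodMk_right hms)]
    congr 1; ext ω'
    simp [sub_lt_iff_lt_add]
  have hm : Measurable fun x : ℝ => μ {ω' | X ω' > x} := by
    have : Antitone fun x : ℝ => μ {ω' | X ω' > x} :=
      fun x y hxy => measure_mono (fun ω (hω : y < X ω) => lt_of_le_of_lt hxy hω)
    exact this.measurable
  simp only [Measure.real]
  have hm2 : Measurable fun ω => μ {ω' | X ω' > u - Y ω} :=
    hm.comp (measurable_const.sub hYm)
  rw [h2, integral_toReal hm2.aemeasurable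
    (Eventually.of_forall fun ω => measure_lt_top _ _)]

lemma replace_tail {Ω : Type*} [MeasurableSpace Ω] (μ : Measure Ω) [IsProbabilityMeasure μ]
    (Z : Ω → ℝ) (hZ : Measurable Z) (hZ0 : ∀ᵐ ω ∂μ, 0 < Z ω) (F f : ℝ → ℝ)
    (hFm : Measurable F) (hfm : Measurable f) (hF1 : ∀ x, |F x| ≤ 1) (hf0 : ∀ x, 0 < x → 0 ≤ f x)
    (h : F ~[atTop] f) :
    (fun v => ∫ ω, F (v + Z ω) ∂μ) ~[atTop] fun v => ∫ ω, f (v + Z ω) ∂μ := by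
  have hb : ∀ᶠ x in atTop, |f x| ≤ 2 := by
    filter_upwards [h.isLittleO.bound (show (0:ℝ) < 1/2 by norm_num)] with x hx
    have h1 := hF1 x
    have h2 : |f x| ≤ |F x| + |F x - f x| := by
      have := abs_sub (F x) (F x - f x); simpa using this
    simp only [Pi.sub_apply, Real.norm_eq_abs] at hx
    linarith
  have hFi : ∀ v, Integrable (fun ω => F (v + Z ω)) μ := fun v =>
    Integrable.of_bound (hFm.comp (measurable_const.add hZ)).aestronglyMeasurable 1
      (Eventually.of_forall fun ω => hF1 _)
  obtain ⟨x1, hx1⟩ := eventually_atTop.1 hb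
  have hfi : ∀ v, x1 ≤ v → Integrable (fun ω => f (v + Z ω)) μ := fun v hv =>
    Integrable.of_bound (hfm.comp (measurable_const.add hZ)).aestronglyMeasurable 2
      (by filter_upwards [hZ0] with ω hω using hx1 _ (by linarith))
  refine IsLittleO.of_bound fun c hc => ?_
  obtain ⟨x2, hx2⟩ := eventually_atTop.1 (h.isLittleO.bound hc)
  filter_upwards [eventually_ge_atTop x1, eventually_ge_atTop x2, eventually_ge_atTop 0] with v h1 h2 h3
  simp only [Pi.sub_apply]
  rw [← integral_sub (hFi v) (hfi v h1)]
  have hn : 0 ≤ ∫ ω, f (v + Z ω) ∂μ := integral_nonneg_of_ae (by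
    filter_upwards [hZ0] with ω hω using hf0 _ (by linarith))
  rw [Real.norm_of_nonneg hn, ← integral_const_mul]
  refine norm_integral_le_of_norm_le ((hfi v h1).const_mul c) ?_
  filter_upwards [hZ0] with ω hω
  have := hx2 (v + Z ω) (by linarith)
  rwa [Real.norm_of_nonneg (hf0 (v + Z ω) (by linarith))] at this

lemma f_scale (CX KX α γ v z : ℝ) (hKX : 0 < KX) (hα : 1 < α) (hv : 0 < v) (hz : 0 ≤ z) :
    CX * (v + z) ^ γ * Real.exp (-KX * (v + z) ^ α) =
      CX * v ^ γ * Real.exp (-KX * v ^ α) *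
        auxH γ α (1 / (KX * α * v ^ α)) (KX * α * v ^ (α - 1) * z) := by
  have e : 1 / (KX * α * v ^ α) * (KX * α * v ^ (α - 1) * z) = z / v := by
    rw [Real.rpow_sub_one hv.ne']
    have : 0 < v ^ α := by positivity
    have : 0 < α := by positivity
    field_simp
  have hs : 0 ≤ 1 + z / v := by positivity
  have e2 : v + z = v * (1 + z / v) := by field_simp
  unfold auxH
  rw [e, e2, Real.mul_rpow hv.le hs, Real.mul_rpow hv.le hs]
  have e3 : Real.exp (-KX * (v ^ α * (1 + z / v) ^ α)) = Real.exp (-KX * v ^ α) *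
     Real.exp (-(((1 + z / v) ^ α - 1) / (α * (1 / (KX * α * v ^ α))))) := by
    rw [← Real.exp_add]
    congr 1
    have : 0 < v ^ α := by positivity
    have : 0 < α := by positivity
    field_simp
    ring
  rw [e3]; ring

theorem tail_sum_exp_power
    {Ω : Type*} [MeasurableSpace Ω] (μ : Measure Ω) [IsProbabilityMeasure μ]
    (X Y : Ω → ℝ) (hXm : Measurable X) (hYm : Measurable Y)
    (hindep : IndepFun X Y μ)
    (CX KX α γ CY mu σ : ℝ)
    (hCX : 0 < CX) (hKX : 0 < KX) (hα : 1 < α) (hCY : 0 < CY) (hmu : 0 < mu)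
    (hsup : essSup Y μ = σ)
    (hX : (fun u => (μ {ω | X ω > u}).toReal)
        ~[atTop] fun u => CX * u ^ γ * Real.exp (-KX * u ^ α))
    (hY : (fun u => (μ {ω | Y ω > u}).toReal)
        ~[𝓝[<] σ] fun u => CY * (σ - u) ^ mu) :
    (fun u => (μ {ω | X ω + Y ω > u}).toReal)
      ~[atTop] fun u =>
        CX * CY * (KX * α) ^ (-mu) * Real.Gamma (mu + 1) *
          u ^ (mu + γ - α * mu) * Real.exp (-KX * (u - σ) ^ α) := by
  have hα0 : 0 < α := by positivity
  set Z : Ω → ℝ := fun ω => σ - Y ω with hZdef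
  have hZ : Measurable Z := measurable_const.sub hYm
  have hsub : Tendsto (fun z : ℝ => σ - z) (𝓝[>] 0) (𝓝[<] σ) := by
    refine tendsto_nhdsWithin_iff.2 ⟨?_, ?_⟩
    · have : ContinuousAt (fun z : ℝ => σ - z) 0 := by fun_prop
      simpa [ContinuousAt] using this.tendsto.mono_left nhdsWithin_le_nhds
    · filter_upwards [self_mem_nhdsWithin] with z hz
      have hz : 0 < z := hz
      simpa using hz
  have hG : (fun z => μ.real {ω | Z ω < z}) ~[𝓝[>] 0] fun z => CY * z ^ mu := by
    have h := hY.comp_tendsto hsub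
    have e1 : ((fun u => (μ {ω | Y ω > u}).toReal) ∘ fun z : ℝ => σ - z) =
        fun z => μ.real {ω | Z ω < z} := by
      funext z
      simp only [Function.comp_def, Measure.real]
      congr 2; ext ω; simp only [Set.mem_ofPred_eq, hZdef]
      constructor <;> intro h <;> linarith
    have e2 : ((fun u => CY * (σ - u) ^ mu) ∘ fun z : ℝ => σ - z) = fun z => CY * z ^ mu := by
      funext z; simp
    rwa [e1, e2] at h
  have hZ0 : ∀ᵐ ω ∂μ, 0 < Z ω := by
    have l1 : Tendsto (fun z : ℝ => CY * z ^ mu) (𝓝[>] 0) (𝓝 0) := by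
      have : ContinuousAt (fun z : ℝ => CY * z ^ mu) 0 :=
        continuousAt_const.mul (Real.continuousAt_rpow_const _ _ (Or.inr hmu.le))
      have h := this.tendsto.mono_left (nhdsWithin_le_nhds (s := Set.Ioi 0))
      simpa [Real.zero_rpow hmu.ne'] using h
    have l2 := hG.symm.tendsto_nhds l1
    have l3 : μ.real {ω | Z ω ≤ 0} ≤ 0 := by
      refine ge_of_tendsto l2 ?_
      filter_upwards [self_mem_nhdsWithin] with z hz
      exact measureReal_mono fun ω (hω : Z ω ≤ 0) => lt_of_le_of_lt hω hz
    have l4 : μ.real {ω | Z ω ≤ 0} = 0 := le_antisymm l3 measureReal_nonneg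
    rw [measureReal_eq_zero_iff] at l4
    rw [ae_iff]
    simpa using l4
  set F : ℝ → ℝ := fun x => μ.real {ω | X ω > x} with hFdef
  set f : ℝ → ℝ := fun u => CX * u ^ γ * Real.exp (-KX * u ^ α) with hfdef
  have hFm : Measurable F := by
    have : Antitone F := fun x y hxy =>
      measureReal_mono (fun ω (hω : y < X ω) => lt_of_le_of_lt hxy hω)
    exact this.measurable
  have hfm : Measurable f := by rw [hfdef]; fun_prop
  have s1 := replace_tail μ Z hZ hZ0 F f hFm hfm
    (fun x => by rw [abs_of_nonneg measureReal_nonneg]; exact measureReal_le_one)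
    (fun x hx => by simp only [hfdef]; positivity) hX
  have s2 : (fun v => ∫ ω, f (v + Z ω) ∂μ) ~[atTop] fun v =>
      CX * CY * (KX * α) ^ (-mu) * Real.Gamma (mu + 1) *
          v ^ (mu + γ - α * mu) * Real.exp (-KX * v ^ α) := by
    have hvα : Tendsto (fun v : ℝ => KX * α * v ^ α) atTop atTop :=
      (tendsto_rpow_atTop hα0).const_mul_atTop (by positivity)
    have hs := scaled μ Z hZ hZ0 γ α CY mu hα hmu hCY hG
      (fun v => KX * α * v ^ (α - 1)) (fun v => 1 / (KX * α * v ^ α))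
      ((tendsto_rpow_atTop (by linarith)).const_mul_atTop (by positivity))
      (by
        simp only [one_div]
        exact tendsto_inv_atTop_nhdsGT_zero.comp hvα)
    have hΓ : 0 < Real.Gamma (mu + 1) := Real.Gamma_pos_of_pos (by positivity)
    refine (isEquivalent_iff_tendsto_one ?_).2 ?_
    · filter_upwards [eventually_gt_atTop 0] with v hv
      positivity
    have hs2 := hs.div_const (CY * Real.Gamma (mu + 1))
    rw [div_self (by positivity)] at hs2
    refine hs2.congr' ?_
    filter_upwards [eventually_gt_atTop 0] with v hv
    have e : ∫ ω, f (v + Z ω) ∂μ = f v *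
        ∫ ω, auxH γ α (1 / (KX * α * v ^ α)) (KX * α * v ^ (α - 1) * Z ω) ∂μ := by
      rw [← integral_const_mul]
      refine integral_congr_ae ?_
      filter_upwards [hZ0] with ω hω
      exact f_scale CX KX α γ v (Z ω) hKX hα hv hω.le
    simp only [Pi.div_apply]
    rw [e, Real.mul_rpow (by positivity) (by positivity), ← Real.rpow_mul hv.le,
      Real.rpow_neg (by positivity)]
    have e2 : mu + γ - α * mu = γ - (α - 1) * mu := by ring
    rw [e2, Real.rpow_sub hv γ ((α - 1) * mu)]
    generalize ∫ ω, auxH γ α (1 / (KX * α * v ^ α)) (KX * α * v ^ (α - 1) * Z ω) ∂μ = I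
    simp only [hfdef]
    have : 0 < v ^ γ := by positivity
    have : 0 < v ^ ((α - 1) * mu) := by positivity
    have : 0 < (KX * α) ^ mu := by positivity
    have : 0 < Real.exp (-KX * v ^ α) := by positivity
    generalize (KX * α) ^ mu = A at *
    generalize Real.exp (-KX * v ^ α) = B at *
    generalize v ^ ((α - 1) * mu) = D at *
    generalize v ^ γ = E at *
    field_simp
  have hshift : Tendsto (fun u : ℝ => u - σ) atTop atTop :=
    tendsto_atTop_add_const_right atTop (-σ) tendsto_id
  have s3 := (s1.trans s2).comp_tendsto hshift
  have e0 : ((fun v => ∫ ω, F (v + Z ω) ∂μ) ∘ fun u : ℝ => u - σ) =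
      fun u => (μ {ω | X ω + Y ω > u}).toReal := by
    funext u
    have := indep_tail μ X Y hXm hYm hindep u
    simp only [Function.comp_def]
    rw [show (μ {ω | X ω + Y ω > u}).toReal = μ.real {ω | X ω + Y ω > u} from rfl, this]
    refine integral_congr_ae (Eventually.of_forall fun ω => ?_)
    simp only [hFdef, hZdef]
    rw [show u - σ + (σ - Y ω) = u - Y ω by ring]
  rw [e0] at s3
  refine s3.trans ?_
  have hp : (fun u : ℝ => (u - σ) ^ (mu + γ - α * mu)) ~[atTop] fun u => u ^ (mu + γ - α * mu) := by
    refine (isEquivalent_iff_tendsto_one ?_).2 ?_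
    · filter_upwards [eventually_gt_atTop 0] with v hv
      positivity
    have h1 : Tendsto (fun u : ℝ => 1 - σ / u) atTop (𝓝 1) := by
      simpa using (tendsto_id.const_div_atTop σ).const_sub 1
    have h2 := h1.rpow_const (p := mu + γ - α * mu) (Or.inl one_ne_zero)
    rw [Real.one_rpow] at h2
    refine h2.congr' ?_
    filter_upwards [eventually_gt_atTop 0, eventually_ge_atTop σ] with v hv hv2
    simp only [Pi.div_apply]
    rw [← Real.div_rpow (by linarith) hv.le, sub_div, div_self hv.ne']
  exact ((IsEquivalent.refl (u := fun _ : ℝ =>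
    CX * CY * (KX * α) ^ (-mu) * Real.Gamma (mu + 1))).mul hp).mul
    (IsEquivalent.refl (u := fun u : ℝ => Real.exp (-KX * (u - σ) ^ α)))
end

section
/- Fix constants K, α > 0 with α > 1, β ∈ ℝ, μ > 0, δ > 0. Then as u → ∞, the integral I(u) := ∫_0^δ z^μ (u+z)^β exp(-K (u+z)^α) dz satisfies I(u) ~ (Kα)^{-μ-1} Γ(μ+1) u^{β - (α-1)(μ+1)} exp(-K u^α). -/
open Filter Asymptotics

open MeasureTheory Set Topology in
theorem laplace_aux
    (K α β mu δ : ℝ) (hK : 0 < K) (hα : 1 < α) (hmu : 0 < mu) (hδ : 0 < δ) :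
    Tendsto (fun u : ℝ => ∫ x in Ioi (0:ℝ), (Ioc 0 (δ * (K * α * u ^ (α - 1)))).indicator
      (fun x => x ^ mu * (1 + x / (K * α * u ^ α)) ^ β *
        Real.exp (-K * u ^ α * ((1 + x / (K * α * u ^ α)) ^ α - 1))) x) atTop
      (𝓝 (Real.Gamma (mu + 1))) := by
  have hα0 : 0 < α := by linarith
  have hKα : 0 < K * α := by positivity
  rw [Real.Gamma_eq_integral (by linarith)]
  apply tendsto_integral_filter_of_dominated_convergence
    (fun x => 2 ^ |β| * (Real.exp (-x) * x ^ (mu + 1 - 1)))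
  · refine Eventually.of_forall fun u => ?_
    apply Measurable.aestronglyMeasurable
    apply Measurable.indicator _ measurableSet_Ioc
    fun_prop
  · filter_upwards [eventually_gt_atTop 0, eventually_ge_atTop δ] with u hu hud
    filter_upwards [ae_restrict_mem measurableSet_Ioi] with x hx
    have hx : 0 < x := hx
    have hua : 0 < u ^ α := Real.rpow_pos_of_pos hu _
    by_cases hm : x ∈ Ioc 0 (δ * (K * α * u ^ (α - 1)))
    · rw [indicator_of_mem hm]
      have ht : 0 < x / (K * α * u ^ α) := by positivity
      have hb := one_add_mul_self_le_rpow_one_add (s := x / (K * α * u ^ α)) (by linarith) hα.le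
      have ht1 : x / (K * α * u ^ α) ≤ 1 := by
        rw [div_le_one (by positivity)]
        refine hm.2.trans ?_
        have : u ^ α = u * u ^ (α - 1) := by
          rw [← Real.rpow_one_add' hu.le (by linarith)]; congr 1; ring
        rw [this]
        have h2 : 0 < u ^ (α - 1) := Real.rpow_pos_of_pos hu _
        calc δ * (K * α * u ^ (α - 1)) ≤ u * (K * α * u ^ (α - 1)) := by gcongr
          _ = _ := by ring
      have hpow : (1 + x / (K * α * u ^ α)) ^ β ≤ 2 ^ |β| :=
        calc (1 + x / (K * α * u ^ α)) ^ β ≤ (1 + x / (K * α * u ^ α)) ^ |β| :=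
              Real.rpow_le_rpow_of_exponent_le (by linarith) (le_abs_self _)
          _ ≤ 2 ^ |β| := Real.rpow_le_rpow (by positivity) (by linarith) (abs_nonneg _)
      have hexp : Real.exp (-K * u ^ α * ((1 + x / (K * α * u ^ α)) ^ α - 1)) ≤ Real.exp (-x) := by
        apply Real.exp_le_exp.2
        have h1 : K * u ^ α * (α * (x / (K * α * u ^ α))) = x := by field_simp
        have h2 : K * u ^ α * (α * (x / (K * α * u ^ α))) ≤
          K * u ^ α * ((1 + x / (K * α * u ^ α)) ^ α - 1) := by
          apply mul_le_mul_of_nonneg_left _ (by positivity)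
          linarith
        linarith
      rw [Real.norm_of_nonneg (by positivity)]
      calc _ ≤ x ^ mu * 2 ^ |β| * Real.exp (-x) := by gcongr
        _ = _ := by rw [add_sub_cancel_right]; ring
    · rw [indicator_of_notMem hm, norm_zero]
      positivity
  · exact (Real.GammaIntegral_convergent (by linarith)).const_mul _
  · filter_upwards [ae_restrict_mem measurableSet_Ioi] with x hx
    have hx : 0 < x := hx
    have hU : Tendsto (fun u : ℝ => K * α * u ^ α) atTop atTop :=
      (tendsto_rpow_atTop hα0).const_mul_atTop hKα
    have ht : Tendsto (fun u : ℝ => x / (K * α * u ^ α)) atTop (𝓝 0) :=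
      hU.const_div_atTop x
    have ht1 : Tendsto (fun u : ℝ => 1 + x / (K * α * u ^ α)) atTop (𝓝 1) := by
      simpa using ht.const_add 1
    have hpow : Tendsto (fun u : ℝ => (1 + x / (K * α * u ^ α)) ^ β) atTop (𝓝 1) := by
      simpa using ht1.rpow_const (p := β) (Or.inl one_ne_zero)
    have hd : HasDerivAt (fun y : ℝ => y ^ α) α 1 := by
      simpa using Real.hasDerivAt_rpow_const (x := 1) (p := α) (Or.inl one_ne_zero)
    have hsl := hd.tendsto_slope_zero
    have htn : Tendsto (fun u : ℝ => x / (K * α * u ^ α)) atTop (𝓝[≠] 0) := by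
      apply tendsto_nhdsWithin_iff.2 ⟨ht, ?_⟩
      filter_upwards [eventually_gt_atTop 0] with u hu
      have hua : 0 < u ^ α := Real.rpow_pos_of_pos hu _
      have : 0 < x / (K * α * u ^ α) := by positivity
      exact this.ne'
    have hs := (hsl.comp htn).const_mul (-(x / α))
    have hE : Tendsto (fun u : ℝ => -K * u ^ α * ((1 + x / (K * α * u ^ α)) ^ α - 1)) atTop
        (𝓝 (-x)) := by
      have : -(x / α) * α = -x := by field_simp
      rw [this] at hs
      refine hs.congr' ?_
      filter_upwards [eventually_gt_atTop 0] with u hu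
      have hua : 0 < u ^ α := Real.rpow_pos_of_pos hu _
      simp only [Function.comp, Real.one_rpow, smul_eq_mul]
      rw [inv_div]
      field_simp
    have hfin := (hpow.const_mul (x ^ mu)).mul (Real.continuous_exp.continuousAt.tendsto.comp hE)
    have e : x ^ mu * 1 * Real.exp (-x) = Real.exp (-x) * x ^ (mu + 1 - 1) := by
      rw [add_sub_cancel_right]; ring
    rw [e] at hfin
    refine hfin.congr' ?_
    have hS : Tendsto (fun u : ℝ => δ * (K * α * u ^ (α - 1))) atTop atTop :=
      ((tendsto_rpow_atTop (by linarith)).const_mul_atTop hKα).const_mul_atTop hδ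
    filter_upwards [hS.eventually_ge_atTop x] with u hu
    rw [indicator_of_mem (show x ∈ Ioc 0 _ from ⟨hx, hu⟩)]
    rfl

open MeasureTheory Set in
theorem laplace_aux2
    (K α β mu δ u : ℝ) (hK : 0 < K) (hα : 1 < α) (hmu : 0 < mu) (hδ : 0 < δ) (hu : 0 < u) :
    (∫ z in (0:ℝ)..δ, z ^ mu * (u + z) ^ β * Real.exp (-K * (u + z) ^ α)) =
    ((K * α) ^ (-mu - 1) * u ^ (β - (α - 1) * (mu + 1)) * Real.exp (-K * u ^ α)) *
    ∫ x in Ioi (0:ℝ), (Ioc 0 (δ * (K * α * u ^ (α - 1)))).indicator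
      (fun x => x ^ mu * (1 + x / (K * α * u ^ α)) ^ β *
        Real.exp (-K * u ^ α * ((1 + x / (K * α * u ^ α)) ^ α - 1))) x := by
  have hα0 : 0 < α := by linarith
  have hKα : 0 < K * α := by positivity
  have h2 : 0 < u ^ (α - 1) := Real.rpow_pos_of_pos hu _
  have hua : u ^ α = u * u ^ (α - 1) := by
    rw [← Real.rpow_one_add' hu.le (by linarith)]; congr 1; ring
  have hc : (K * α) ^ (-mu - 1) * u ^ (β - (α - 1) * (mu + 1)) =
      (K * α * u ^ (α - 1)) ^ (-mu - 1) * u ^ β := by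
    rw [Real.mul_rpow hKα.le h2.le, ← Real.rpow_mul hu.le, mul_assoc, ← Real.rpow_add hu]
    congr 2; ring
  rw [hc, setIntegral_indicator measurableSet_Ioc, inter_eq_self_of_subset_right
    (Ioc_subset_Ioi_self), hua]
  set s := K * α * u ^ (α - 1) with hs
  have hs0 : 0 < s := by positivity
  have hsu : K * α * (u * u ^ (α - 1)) = s * u := by rw [hs]; ring
  rw [hsu, ← hua, ← intervalIntegral.integral_of_le (by positivity),
    ← intervalIntegral.integral_const_mul]
  have := intervalIntegral.integral_comp_div (a := 0) (b := δ * s)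
    (fun z => z ^ mu * (u + z) ^ β * Real.exp (-K * (u + z) ^ α)) hs0.ne'
  rw [zero_div, mul_div_cancel_right₀ _ hs0.ne', smul_eq_mul] at this
  rw [eq_comm, ← mul_right_inj' hs0.ne', ← this, ← intervalIntegral.integral_const_mul]
  apply intervalIntegral.integral_congr
  intro x hx
  rw [uIcc_of_le (by positivity)] at hx
  have hx0 : 0 ≤ x := hx.1
  have e1 : u + x / s = u * (1 + x / (s * u)) := by field_simp
  have hp : 0 ≤ 1 + x / (s * u) := by positivity
  have e2 : s * s ^ (-mu - 1) = (s ^ mu)⁻¹ := by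
    rw [← Real.rpow_neg hs0.le, ← Real.rpow_one_add' hs0.le (by simp; linarith)]
    congr 1; ring
  have e3 : -K * (u ^ α * (1 + x / (s * u)) ^ α) =
    -K * u ^ α + -K * u ^ α * ((1 + x / (s * u)) ^ α - 1) := by ring
  simp only
  rw [e1, Real.mul_rpow hu.le hp, Real.mul_rpow hu.le hp, Real.div_rpow hx0 hs0.le, e3,
    Real.exp_add, div_eq_mul_inv (x ^ mu), ← e2]
  generalize s ^ (-mu - 1) = A
  generalize (1 + x / (s * u)) ^ β = B
  generalize Real.exp (-K * u ^ α * ((1 + x / (s * u)) ^ α - 1)) = C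
  ring

theorem laplace_integral_asymptotics
    (K α β mu δ : ℝ) (hK : 0 < K) (hα : 1 < α) (hmu : 0 < mu) (hδ : 0 < δ) :
    (fun u : ℝ => ∫ z in (0:ℝ)..δ, z ^ mu * (u + z) ^ β * Real.exp (-K * (u + z) ^ α))
      ~[atTop] fun u =>
        (K * α) ^ (-mu - 1) * Real.Gamma (mu + 1) *
          u ^ (β - (α - 1) * (mu + 1)) * Real.exp (-K * u ^ α) := by
  have hG : Real.Gamma (mu + 1) ≠ 0 := (Real.Gamma_pos_of_pos (by linarith)).ne'
  have h := (isEquivalent_const_iff_tendsto hG).2 (laplace_aux K α β mu δ hK hα hmu hδ)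
  have h' := (IsEquivalent.refl (l := atTop) (u := fun u : ℝ =>
    (K * α) ^ (-mu - 1) * u ^ (β - (α - 1) * (mu + 1)) * Real.exp (-K * u ^ α))).mul h
  refine (h'.congr_left ?_).congr_right ?_
  · filter_upwards [eventually_gt_atTop 0] with u hu
    exact (laplace_aux2 K α β mu δ u hK hα hmu hδ hu).symm
  · refine Eventually.of_forall fun u => ?_
    simp only [Pi.mul_apply, Function.const]
    ring
end

section
/- Let X ≥ 0 a.s. and Y be independent random variables. Suppose there exists a function φ: ℝ₊ → ℝ₊ with φ(u) → ∞, φ(u)/u → 0, P(X > φ(u)) = o(P(Y > u)), and P(Y > u - φ(u)) ~ P(Y > u) as u → ∞. Then P(X + Y > u) ~ P(Y > u) as u → ∞. -/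
open MeasureTheory ProbabilityTheory Filter Asymptotics Topology

theorem tail_sum_dominated_nonneg
    {Ω : Type*} [MeasurableSpace Ω] (μ : Measure Ω) [IsProbabilityMeasure μ]
    (X Y : Ω → ℝ) (hXm : Measurable X) (hYm : Measurable Y)
    (hindep : IndepFun X Y μ)
    (hXpos : ∀ᵐ ω ∂μ, 0 ≤ X ω)
    (φ : ℝ → ℝ) (hφnonneg : ∀ u, 0 ≤ φ u)
    (hφtop : Tendsto φ atTop atTop)
    (hφu : Tendsto (fun u => φ u / u) atTop (𝓝 0))
    (hφo : (fun u => (μ {ω | X ω > φ u}).toReal)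
        =o[atTop] fun u => (μ {ω | Y ω > u}).toReal)
    (hφY : (fun u => (μ {ω | Y ω > u - φ u}).toReal)
        ~[atTop] fun u => (μ {ω | Y ω > u}).toReal) :
    (fun u => (μ {ω | X ω + Y ω > u}).toReal)
      ~[atTop] fun u => (μ {ω | Y ω > u}).toReal := by
  have hsum := hφY.isLittleO.add hφo
  refine IsBigO.trans_isLittleO (IsBigO.of_bound 1 (Eventually.of_forall fun u => ?_)) hsum
  have h1 : (μ {ω | Y ω > u}).toReal ≤ (μ {ω | X ω + Y ω > u}).toReal := by
    refine ENNReal.toReal_mono (measure_ne_top _ _) (measure_mono_ae ?_)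
    filter_upwards [hXpos] with ω h0 h
    have h' : Y ω > u := h
    show X ω + Y ω > u
    linarith
  have h2 : (μ {ω | X ω + Y ω > u}).toReal
      ≤ (μ {ω | Y ω > u - φ u}).toReal + (μ {ω | X ω > φ u}).toReal := by
    rw [← ENNReal.toReal_add (measure_ne_top _ _) (measure_ne_top _ _)]
    refine ENNReal.toReal_mono (by finiteness) (le_trans (measure_mono ?_) (measure_union_le _ _))
    intro ω h
    have h' : X ω + Y ω > u := h
    by_cases hx : X ω > φ u
    · exact Or.inr hx
    · left
      show Y ω > u - φ u
      linarith
  simp only [Pi.sub_apply, one_mul, Real.norm_eq_abs]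
  rw [abs_of_nonneg (by linarith), abs_of_nonneg (by linarith)]
  linarith
end

section
/- Let X and Y be independent, a.s. strictly positive random variables with P(X > u) ~ C_X u^γ exp(-K_X u^α) as u → ∞ (C_X, K_X, α > 0, γ ∈ ℝ), and ess sup Y = σ > 0 with P(Y > u) ~ C_Y (σ - u)^μ as u ↑ σ (C_Y, μ > 0). Then P(XY > u) ~ C_X C_Y Γ(μ+1) σ^{αμ + μ - γ} (K_X α)^{-μ} u^{γ - αμ} exp(-K_X σ^{-α} u^α) as u → ∞. -/
open MeasureTheory ProbabilityTheory Filter Asymptotics Topology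

lemma aux_laplace_eq {Ω : Type*} [MeasurableSpace Ω] (μ : Measure Ω) [IsProbabilityMeasure μ]
    (Z : Ω → ℝ) (hZ : Measurable Z) (hZ0 : ∀ᵐ ω ∂μ, 0 ≤ Z ω) :
    ∫ ω, Real.exp (-Z ω) ∂μ = ∫ t in Set.Ioi (0:ℝ), (μ {ω | Z ω < t}).toReal * Real.exp (-t) := by
  have h1 : ∀ᵐ ω ∂μ, Real.exp (-Z ω) =
      ∫ t in Set.Ioi (0:ℝ), (if Z ω < t then (1:ℝ) else 0) * Real.exp (-t) := by
    filter_upwards [hZ0] with ω h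
    have : ∀ t : ℝ, (if Z ω < t then (1:ℝ) else 0) * Real.exp (-t)
        = (Set.Ioi (Z ω)).indicator (fun t => Real.exp (-t)) t := by
      intro t; by_cases ht : Z ω < t <;> simp [Set.indicator, ht]
    simp_rw [this]
    rw [setIntegral_indicator measurableSet_Ioi, Set.Ioi_inter_Ioi, sup_eq_right.2 h, integral_exp_neg_Ioi]
  rw [integral_congr_ae h1]
  rw [integral_integral_swap]
  · apply integral_congr_ae
    filter_upwards with t
    rw [integral_mul_const]
    congr 1
    have : ∀ ω, (if Z ω < t then (1:ℝ) else 0) = ({ω | Z ω < t}).indicator (fun _ => (1:ℝ)) ω := by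
      intro ω; simp [Set.indicator]
    simp_rw [this]
    rw [integral_indicator (measurableSet_lt hZ measurable_const)]
    simp [Measure.real]
  · have hi : Integrable (fun p : Ω × ℝ => (1:ℝ) * Real.exp (-p.2)) (μ.prod (volume.restrict (Set.Ioi 0))) := by
      have h2 : IntegrableOn (fun t : ℝ => Real.exp (-t)) (Set.Ioi 0) := by
        exact integrableOn_exp_neg_Ioi 0
      exact (integrable_const (1:ℝ)).mul_prod h2
    refine hi.mono ?_ ?_
    · apply Measurable.aestronglyMeasurable
      refine Measurable.mul (Measurable.ite ?_ measurable_const measurable_const) (by fun_prop)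
      exact measurableSet_lt (hZ.comp measurable_fst) measurable_snd
    · filter_upwards with p
      simp only [Function.uncurry, norm_mul]
      gcongr
      split_ifs <;> simp

lemma aux_abel {Ω : Type*} [MeasurableSpace Ω] (μ : Measure Ω) [IsProbabilityMeasure μ]
    (Z : Ω → ℝ) (hZ : Measurable Z) (hZ0 : ∀ᵐ ω ∂μ, 0 ≤ Z ω) (C m : ℝ) (hm : 0 < m)
    (h : Tendsto (fun z => (μ {ω | Z ω < z}).toReal / z ^ m) (𝓝[>] 0) (𝓝 C)) :
    Tendsto (fun l : ℝ => l ^ m * ∫ ω, Real.exp (-(l * Z ω)) ∂μ) atTop (𝓝 (C * Real.Gamma (m + 1))) := by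
  -- global bound
  obtain ⟨B, hB0, hB⟩ : ∃ B : ℝ, 0 ≤ B ∧ ∀ z > 0, (μ {ω | Z ω < z}).toReal ≤ B * z ^ m := by
    have h1 : ∀ᶠ z in 𝓝[>] (0:ℝ), (μ {ω | Z ω < z}).toReal / z ^ m < C + 1 :=
      h.eventually (gt_mem_nhds (by linarith))
    obtain ⟨d, hd, hd'⟩ := mem_nhdsGT_iff_exists_Ioo_subset.1 h1
    simp only [Set.mem_Ioi] at hd
    refine ⟨max (|C| + 1) (d ^ (-m)), by positivity, fun z hz => ?_⟩
    have hzm : 0 < z ^ m := by positivity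
    rcases lt_or_ge z d with hzd | hzd
    · have := hd' ⟨hz, hzd⟩
      simp only [Set.mem_ofPred_eq] at this
      rw [div_lt_iff₀ hzm] at this
      refine this.le.trans ?_
      gcongr
      exact le_trans (by linarith [le_abs_self C]) (le_max_left _ _)
    · calc (μ {ω | Z ω < z}).toReal ≤ 1 := measureReal_le_one
        _ = d ^ (-m) * d ^ m := by rw [← Real.rpow_add hd]; simp
        _ ≤ max (|C| + 1) (d ^ (-m)) * z ^ m := by
            gcongr
            exact le_max_right _ _
  have hG : C * Real.Gamma (m + 1) = ∫ t in Set.Ioi (0:ℝ), C * (Real.exp (-t) * t ^ m) := by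
    rw [integral_const_mul, Real.Gamma_eq_integral (by linarith)]; simp
  have hGi : IntegrableOn (fun t : ℝ => Real.exp (-t) * t ^ m) (Set.Ioi 0) := by
    simpa using Real.GammaIntegral_convergent (s := m + 1) (by linarith)
  have hrew : ∀ᶠ l : ℝ in atTop, ∫ t in Set.Ioi (0:ℝ), l ^ m * ((μ {ω | l * Z ω < t}).toReal * Real.exp (-t))
      = l ^ m * ∫ ω, Real.exp (-(l * Z ω)) ∂μ := by
    filter_upwards [eventually_gt_atTop 0] with l hl
    rw [aux_laplace_eq μ (fun ω => l * Z ω) (hZ.const_mul l) (by filter_upwards [hZ0] with ω h; positivity),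
      integral_const_mul]
  refine Tendsto.congr' hrew ?_
  rw [hG]
  have hset : ∀ l : ℝ, 0 < l → ∀ t, {ω | l * Z ω < t} = {ω | Z ω < t / l} := by
    intro l hl t; ext ω; simp [lt_div_iff₀ hl, mul_comm]
  refine tendsto_integral_filter_of_dominated_convergence (fun t => B * (Real.exp (-t) * t ^ m)) ?_ ?_ (hGi.const_mul B) ?_
  · filter_upwards with l
    apply Measurable.aestronglyMeasurable
    refine Measurable.const_mul (Measurable.mul ?_ (by fun_prop)) _
    refine Monotone.measurable fun a b hab => ?_
    exact ENNReal.toReal_mono (measure_ne_top _ _) (measure_mono fun ω hω => lt_of_lt_of_le hω hab)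
  · filter_upwards [eventually_gt_atTop 0] with l hl
    filter_upwards [ae_restrict_mem measurableSet_Ioi] with t ht
    simp only [Set.mem_Ioi] at ht
    rw [Real.norm_of_nonneg (by positivity), hset l hl]
    have := hB (t / l) (by positivity)
    rw [Real.div_rpow ht.le hl.le] at this
    calc _ ≤ l ^ m * ((B * (t ^ m / l ^ m)) * Real.exp (-t)) := by gcongr
      _ = _ := by have : 0 < l ^ m := by positivity
                  field_simp
  · filter_upwards [ae_restrict_mem measurableSet_Ioi] with t ht
    simp only [Set.mem_Ioi] at ht
    have h1 : Tendsto (fun l : ℝ => t / l) atTop (𝓝[>] 0) := by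
      refine tendsto_nhdsWithin_iff.2 ⟨tendsto_const_nhds.div_atTop tendsto_id, ?_⟩
      filter_upwards [eventually_gt_atTop 0] with l hl
      exact div_pos ht hl
    refine ((h.comp h1).mul_const (Real.exp (-t) * t ^ m)).congr' ?_
    filter_upwards [eventually_gt_atTop 0] with l hl
    simp only [Function.comp]
    rw [hset l hl, Real.div_rpow ht.le hl.le]
    have : 0 < l ^ m := by positivity
    have : 0 < t ^ m := by positivity
    generalize (μ {ω | Z ω < t / l}).toReal = q
    field_simp

lemma aux_g_bound (a p z : ℝ) (ha : 0 < a) (hz : 0 ≤ z) :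
    |(1 + a * z) ^ p - 1| ≤ (|p| * a) * z * Real.exp ((|p| * a) * z) := by
  have h1 : 0 < 1 + a * z := by positivity
  have hL : |Real.log (1 + a * z) * p| ≤ |p| * a * z := by
    rw [abs_mul, abs_of_nonneg (Real.log_nonneg (by nlinarith [mul_nonneg ha.le hz]))]
    have := Real.log_le_sub_one_of_pos h1
    nlinarith [abs_nonneg p]
  rw [Real.rpow_def_of_pos h1]
  set x := Real.log (1 + a * z) * p
  have h2 : |Real.exp x - 1| ≤ |x| * Real.exp |x| := by
    have e1 := Real.add_one_le_exp x
    have e2 := Real.add_one_le_exp (-x)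
    have e3 : Real.exp x * Real.exp (-x) = 1 := by rw [← Real.exp_add]; simp
    have e4 := Real.exp_pos x
    have e5 := Real.one_le_exp (abs_nonneg x)
    rcases le_total 0 x with hx | hx
    · rw [abs_of_nonneg hx, abs_of_nonneg (by linarith)]
      nlinarith
    · rw [abs_of_nonpos hx] at *
      rw [abs_of_nonpos (by linarith [Real.exp_le_one_iff.2 hx])]
      nlinarith
  calc _ ≤ |x| * Real.exp |x| := h2
    _ ≤ _ := by gcongr

lemma aux_abel_g {Ω : Type*} [MeasurableSpace Ω] (μ : Measure Ω) [IsProbabilityMeasure μ]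
    (Z : Ω → ℝ) (hZ : Measurable Z) (hZ0 : ∀ᵐ ω ∂μ, 0 ≤ Z ω) (C m a p : ℝ) (hm : 0 < m) (ha : 0 < a)
    (h : Tendsto (fun z => (μ {ω | Z ω < z}).toReal / z ^ m) (𝓝[>] 0) (𝓝 C)) :
    (∀ᶠ l : ℝ in atTop, Integrable (fun ω => (1 + a * Z ω) ^ p * Real.exp (-(l * Z ω))) μ) ∧
    Tendsto (fun l : ℝ => l ^ m * ∫ ω, (1 + a * Z ω) ^ p * Real.exp (-(l * Z ω)) ∂μ) atTop
      (𝓝 (C * Real.Gamma (m + 1))) := by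
  have hA := aux_abel μ Z hZ hZ0 C m hm h
  have hint : ∀ l : ℝ, 0 ≤ l → Integrable (fun ω => Real.exp (-(l * Z ω))) μ := by
    intro l hl
    refine (integrable_const (1:ℝ)).mono (by fun_prop) ?_
    filter_upwards [hZ0] with ω hω
    simpa using mul_nonneg hl hω
  set b := |p| * a with hb
  have hb0 : 0 ≤ b := by positivity
  have hbd : ∀ l : ℝ, 0 < l → 4 * b ≤ l → ∀ᵐ ω ∂μ,
      ‖(1 + a * Z ω) ^ p * Real.exp (-(l * Z ω)) - Real.exp (-(l * Z ω))‖ ≤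
        (2 * b / l) * Real.exp (-(l / 4 * Z ω)) := by
    intro l hl hbl
    filter_upwards [hZ0] with ω hω
    have h1 := aux_g_bound a p (Z ω) ha hω
    rw [← hb] at h1
    set z := Z ω
    have e : (1 + a * z) ^ p * Real.exp (-(l * z)) - Real.exp (-(l * z))
      = ((1 + a * z) ^ p - 1) * Real.exp (-(l * z)) := by ring
    rw [e, norm_mul, Real.norm_eq_abs, Real.norm_of_nonneg (Real.exp_pos _).le]
    have h3 : z ≤ 2 / l * Real.exp (l * z / 2) := by
      have := Real.add_one_le_exp (l * z / 2)
      rw [div_mul_eq_mul_div, le_div_iff₀ hl]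
      nlinarith
    calc _ ≤ b * z * Real.exp (b * z) * Real.exp (-(l * z)) := by gcongr
      _ ≤ b * (2 / l * Real.exp (l * z / 2)) * Real.exp (l / 4 * z) * Real.exp (-(l * z)) := by
          gcongr; linarith
      _ = 2 * b / l * Real.exp (l * z / 2 + l / 4 * z + -(l * z)) := by
          rw [Real.exp_add, Real.exp_add]; ring
      _ = _ := by congr 2; ring
  have hdiff : ∀ l : ℝ, 0 < l → 4 * b ≤ l → Integrable (fun ω => (1 + a * Z ω) ^ p * Real.exp (-(l * Z ω)) - Real.exp (-(l * Z ω))) μ := by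
    intro l hl hbl
    refine Integrable.mono' ((hint (l/4) (by positivity)).const_mul (2 * b / l)) ?_ (hbd l hl hbl)
    exact Measurable.aestronglyMeasurable (by fun_prop)
  have hI : ∀ l : ℝ, 0 < l → 4 * b ≤ l → Integrable (fun ω => (1 + a * Z ω) ^ p * Real.exp (-(l * Z ω))) μ := by
    intro l hl hbl
    exact ((hdiff l hl hbl).add (hint l hl.le)).congr (ae_of_all _ fun ω => by simp)
  refine ⟨?_, ?_⟩
  · filter_upwards [eventually_gt_atTop 0, eventually_ge_atTop (4 * b)] with l h1 h2 using hI l h1 h2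
  have hsmall : Tendsto (fun l : ℝ => l ^ m * ∫ ω, ((1 + a * Z ω) ^ p * Real.exp (-(l * Z ω)) - Real.exp (-(l * Z ω))) ∂μ) atTop (𝓝 0) := by
    have h4 : Tendsto (fun l : ℝ => (2 * b / l) * (4 ^ m * ((l / 4) ^ m * ∫ ω, Real.exp (-(l / 4 * Z ω)) ∂μ))) atTop (𝓝 0) := by
      have h5 : Tendsto (fun l : ℝ => l / 4) atTop atTop := tendsto_id.atTop_div_const (by norm_num)
      have := (tendsto_const_nhds (x := 2 * b)).div_atTop tendsto_id |>.mul ((hA.comp h5).const_mul (4 ^ m))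
      simpa using this
    refine squeeze_zero_norm' ?_ h4
    filter_upwards [eventually_gt_atTop 0, eventually_ge_atTop (4 * b)] with l h1 h2
    rw [norm_mul, Real.norm_of_nonneg (by positivity)]
    have := norm_integral_le_of_norm_le ((hint (l/4) (by positivity)).const_mul (2 * b / l)) (hbd l h1 h2)
    rw [integral_const_mul] at this
    refine (mul_le_mul_of_nonneg_left this (by positivity)).trans (le_of_eq ?_)
    · · rw [Real.div_rpow h1.le (by norm_num)]
        generalize ∫ (a : Ω), Real.exp (-(l / 4 * Z a)) ∂μ = q
        field_simp
  have := hA.add hsmall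
  rw [add_zero] at this
  refine this.congr' ?_
  filter_upwards [eventually_gt_atTop 0, eventually_ge_atTop (4 * b)] with l h1 h2
  rw [integral_sub (hI l h1 h2) (hint l h1.le)]
  ring

lemma aux_Z_tail {Ω : Type*} [MeasurableSpace Ω] (μ : Measure Ω) [IsProbabilityMeasure μ]
    (Y : Ω → ℝ) (hYpos : ∀ᵐ ω ∂μ, 0 < Y ω) (α CY m σ : ℝ) (hα : 0 < α) (hCY : 0 < CY)
    (hσ : 0 < σ)
    (hY : (fun u => (μ {ω | Y ω > u}).toReal) ~[𝓝[<] σ] fun u => CY * (σ - u) ^ m) :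
    Tendsto (fun z => (μ {ω | Y ω ^ (-α) - σ ^ (-α) < z}).toReal / z ^ m) (𝓝[>] 0)
      (𝓝 (CY * (σ ^ (1 + α) / α) ^ m)) := by
  have hY' : Tendsto (fun u => (μ {ω | Y ω > u}).toReal / (σ - u) ^ m) (𝓝[<] σ) (𝓝 CY) := by
    have h1 : ∀ᶠ u in 𝓝[<] σ, CY * (σ - u) ^ m ≠ 0 := by
      filter_upwards [self_mem_nhdsWithin] with u hu
      have : 0 < σ - u := sub_pos.2 hu
      positivity
    have h2 := ((isEquivalent_iff_tendsto_one h1).1 hY).const_mul CY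
    rw [mul_one] at h2
    refine h2.congr' ?_
    filter_upwards [self_mem_nhdsWithin] with u hu
    have : 0 < σ - u := sub_pos.2 hu
    have : 0 < (σ - u) ^ m := by positivity
    simp only [Pi.div_apply]
    field_simp
  have hs : 0 < σ ^ (-α) := by positivity
  set q : ℝ → ℝ := fun z => (σ ^ (-α) + z) ^ (-1 / α) with hq
  have hq0 : q 0 = σ := by
    simp only [hq, add_zero]
    rw [← Real.rpow_mul hσ.le]
    have : -α * (-1 / α) = 1 := by field_simp
    rw [this, Real.rpow_one]
  have hqd : HasDerivAt q (-(σ ^ (1 + α) / α)) 0 := by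
    have h1 : HasDerivAt (fun z : ℝ => σ ^ (-α) + z) 1 0 := by
      simpa using (hasDerivAt_id (0:ℝ)).const_add (σ ^ (-α))
    have := h1.rpow_const (p := -1 / α) (Or.inl (by simpa using hs.ne'))
    convert this using 1
    rw [add_zero, ← Real.rpow_mul hσ.le]
    have : -α * (-1 / α - 1) = 1 + α := by field_simp; ring
    rw [this]; ring
  have hlt : ∀ z > 0, q z < σ := by
    intro z hz
    rw [← hq0]
    simp only [hq, add_zero]
    refine Real.rpow_lt_rpow_of_neg hs (by linarith) ?_
    exact div_neg_of_neg_of_pos (by norm_num) hα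
  have hqt : Tendsto q (𝓝[>] 0) (𝓝[<] σ) := by
    refine tendsto_nhdsWithin_iff.2 ⟨?_, ?_⟩
    · have := hqd.continuousAt.tendsto
      rw [hq0] at this
      exact this.mono_left nhdsWithin_le_nhds
    · filter_upwards [self_mem_nhdsWithin] with z hz using hlt z hz
  have hslope : Tendsto (fun z => (σ - q z) / z) (𝓝[>] 0) (𝓝 (σ ^ (1 + α) / α)) := by
    have h1 := (hasDerivAt_iff_tendsto_slope.1 hqd).neg
    rw [neg_neg] at h1
    refine (h1.mono_left (nhdsWithin_mono _ ?_)).congr' ?_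
    · intro x hx; exact (ne_of_gt hx)
    · filter_upwards with z
      rw [slope_def_field, hq0]; simp only [sub_zero]; ring
  have hfin := (hY'.comp hqt).mul (hslope.rpow_const (p := m) (Or.inl (by positivity)))
  refine hfin.congr' ?_
  filter_upwards [self_mem_nhdsWithin] with z hz
  simp only [Set.mem_Ioi] at hz
  have hd : 0 < σ - q z := sub_pos.2 (hlt z hz)
  have he : μ {ω | Y ω ^ (-α) - σ ^ (-α) < z} = μ {ω | Y ω > q z} := by
    apply measure_congr
    filter_upwards [hYpos] with ω hω
    apply propext
    change Y ω ^ (-α) - σ ^ (-α) < z ↔ q z < Y ω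
    have e : Y ω = (Y ω ^ (-α)) ^ (-1 / α) := by
      rw [← Real.rpow_mul hω.le]
      have : -α * (-1 / α) = 1 := by field_simp
      rw [this, Real.rpow_one]
    conv_rhs => rw [e]
    simp only [hq]
    rw [Real.rpow_lt_rpow_iff_of_neg (by positivity) (by positivity) (div_neg_of_neg_of_pos (by norm_num) hα)]
    constructor <;> intro h <;> linarith
  rw [he]
  simp only [Function.comp]
  rw [Real.div_rpow hd.le hz.le]
  have : 0 < (σ - q z) ^ m := by positivity
  have : 0 < z ^ m := by positivity
  field_simp

lemma aux_prod {Ω : Type*} [MeasurableSpace Ω] (μ : Measure Ω) [IsProbabilityMeasure μ]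
    (X Y : Ω → ℝ) (hXm : Measurable X) (hYm : Measurable Y)
    (hindep : IndepFun X Y μ) (hYpos : ∀ᵐ ω ∂μ, 0 < Y ω) (u : ℝ) :
    Integrable (fun ω => (μ {w | X w > u / Y ω}).toReal) μ ∧
    (μ {ω | X ω * Y ω > u}).toReal = ∫ ω, (μ {w | X w > u / Y ω}).toReal ∂μ := by
  have hF : Measurable (fun v => (μ {w | X w > v}).toReal) := by
    refine Antitone.measurable fun a b hab => ?_
    exact ENNReal.toReal_mono (measure_ne_top _ _) (measure_mono fun ω hω => lt_of_le_of_lt hab hω)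
  have hFm : Measurable (fun ω => (μ {w | X w > u / Y ω}).toReal) :=
    hF.comp (hYm.const_div u)
  refine ⟨(integrable_const (1:ℝ)).mono hFm.aestronglyMeasurable (ae_of_all _ fun ω => ?_), ?_⟩
  · rw [Real.norm_of_nonneg ENNReal.toReal_nonneg]
    rw [norm_one]; exact (measureReal_le_one : μ.real {w | X w > u / Y ω} ≤ 1)
  have hS : MeasurableSet {p : ℝ × ℝ | p.2 * p.1 > u} :=
    measurableSet_lt measurable_const (measurable_snd.mul measurable_fst)
  have hmap := (indepFun_iff_map_prod_eq_prod_map_map hYm.aemeasurable hXm.aemeasurable).1 hindep.symm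
  have h1 : μ {ω | X ω * Y ω > u} = ∫⁻ ω, μ {w | X w > u / Y ω} ∂μ := by
    have : μ {ω | X ω * Y ω > u} = (μ.map (fun ω => (Y ω, X ω))) {p : ℝ × ℝ | p.2 * p.1 > u} := by
      rw [Measure.map_apply (hYm.prodMk hXm) hS]; rfl
    have : IsProbabilityMeasure (μ.map X) := Measure.isProbabilityMeasure_map hXm.aemeasurable
    rw [‹μ {ω | X ω * Y ω > u} = _›, hmap, Measure.prod_apply hS, lintegral_map (measurable_measure_prodMk_left hS) hYm]
    apply lintegral_congr_ae
    filter_upwards [hYpos] with ω hω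
    rw [Measure.map_apply hXm (measurable_prodMk_left hS)]
    congr 1
    ext w
    change u < X w * Y ω ↔ u / Y ω < X w
    rw [div_lt_iff₀ hω]
  rw [h1, integral_toReal]
  · have hF2 : Measurable (fun v => μ {w | X w > v}) := by
      refine Antitone.measurable fun a b hab => ?_
      exact (measure_mono fun ω hω => lt_of_le_of_lt hab hω)
    exact (hF2.comp (hYm.const_div u)).aemeasurable
  · exact ae_of_all _ fun ω => measure_lt_top _ _

theorem tail_product_exp_power
    {Ω : Type*} [MeasurableSpace Ω] (μ : Measure Ω) [IsProbabilityMeasure μ]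
    (X Y : Ω → ℝ) (hXm : Measurable X) (hYm : Measurable Y)
    (hindep : IndepFun X Y μ)
    (hXpos : ∀ᵐ ω ∂μ, 0 < X ω) (hYpos : ∀ᵐ ω ∂μ, 0 < Y ω)
    (CX KX α γ CY mu σ : ℝ)
    (hCX : 0 < CX) (hKX : 0 < KX) (hα : 0 < α) (hCY : 0 < CY) (hmu : 0 < mu)
    (hσ : 0 < σ) (hsup : essSup Y μ = σ)
    (hX : (fun u => (μ {ω | X ω > u}).toReal)
        ~[atTop] fun u => CX * u ^ γ * Real.exp (-KX * u ^ α))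
    (hY : (fun u => (μ {ω | Y ω > u}).toReal)
        ~[𝓝[<] σ] fun u => CY * (σ - u) ^ mu) :
    (fun u => (μ {ω | X ω * Y ω > u}).toReal)
      ~[atTop] fun u =>
        CX * CY * Real.Gamma (mu + 1) * σ ^ (α * mu + mu - γ) * (KX * α) ^ (-mu) *
          u ^ (γ - α * mu) * Real.exp (-KX * σ ^ (-α) * u ^ α) := by
  have hYle : ∀ᵐ ω ∂μ, Y ω ≤ σ := by
    rw [← hsup]
    refine ae_le_essSup ?_
    by_contra hne
    have h0 : essSup Y μ = 0 := by
      rw [essSup, limsup_eq]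
      have : {a : ℝ | ∀ᶠ n in ae μ, Y n ≤ a} = ∅ := by
        refine Set.eq_empty_iff_forall_notMem.2 fun a ha => hne ?_
        exact ⟨a, ha⟩
      rw [this, Real.sInf_empty]
    linarith
  set Z : Ω → ℝ := fun ω => Y ω ^ (-α) - σ ^ (-α) with hZdef
  have hZ : Measurable Z := by fun_prop
  have hZ0 : ∀ᵐ ω ∂μ, 0 ≤ Z ω := by
    filter_upwards [hYpos, hYle] with ω h1 h2
    exact sub_nonneg.2 (Real.rpow_le_rpow_of_nonpos h1 h2 (by linarith))
  have hZt : Tendsto (fun z => (μ {ω | Z ω < z}).toReal / z ^ mu) (𝓝[>] 0) _ :=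
    aux_Z_tail μ Y hYpos α CY mu σ hα hCY hσ hY
  obtain ⟨hint, hlim⟩ := aux_abel_g μ Z hZ hZ0 _ mu (σ ^ α) (γ / α) hmu (by positivity) hZt
  set L := CY * (σ ^ (1 + α) / α) ^ mu * Real.Gamma (mu + 1) with hL
  have hG : 0 < Real.Gamma (mu + 1) := Real.Gamma_pos_of_pos (by linarith)
  have hL0 : 0 < L := by positivity
  set f : ℝ → ℝ := fun u => CX * u ^ γ * Real.exp (-KX * u ^ α) with hf
  set ψ : ℝ → ℝ := fun l => ∫ ω, (1 + σ ^ α * Z ω) ^ (γ / α) * Real.exp (-(l * Z ω)) ∂μ with hψ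
  have hl : Tendsto (fun u : ℝ => KX * u ^ α) atTop atTop :=
    (tendsto_rpow_atTop hα).const_mul_atTop hKX
  set A : ℝ → ℝ := fun u => CX * u ^ γ * σ ^ (-γ) * Real.exp (-KX * σ ^ (-α) * u ^ α) with hA
  -- pointwise factorisation
  have hfac : ∀ u : ℝ, 0 < u → ∀ᵐ ω ∂μ, f (u / Y ω) =
      A u * ((1 + σ ^ α * Z ω) ^ (γ / α) * Real.exp (-(KX * u ^ α * Z ω))) := by
    intro u hu
    filter_upwards [hYpos] with ω hω
    have e1 : 1 + σ ^ α * Z ω = (σ / Y ω) ^ α := by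
      simp only [hZdef]
      rw [mul_sub, ← Real.rpow_add hσ, Real.div_rpow hσ.le hω.le, Real.rpow_neg hω.le]
      simp [div_eq_mul_inv]
    have e2 : (1 + σ ^ α * Z ω) ^ (γ / α) = (σ / Y ω) ^ γ := by
      rw [e1, ← Real.rpow_mul (by positivity)]
      congr 1; field_simp
    rw [e2]
    simp only [hf, hA, hZdef]
    have e3 : Real.exp (-KX * (u / Y ω) ^ α) = Real.exp (-KX * σ ^ (-α) * u ^ α) *
        Real.exp (-(KX * u ^ α * (Y ω ^ (-α) - σ ^ (-α)))) := by
      rw [← Real.exp_add]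
      congr 1
      rw [Real.div_rpow hu.le hω.le, Real.rpow_neg hω.le]
      ring
    rw [e3, Real.div_rpow hu.le hω.le, Real.div_rpow hσ.le hω.le, Real.rpow_neg hσ.le γ]
    have := Real.rpow_pos_of_pos hσ γ
    have := Real.rpow_pos_of_pos hω γ
    field_simp
  have hIeq : ∀ u : ℝ, 0 < u → ∫ ω, f (u / Y ω) ∂μ = A u * ψ (KX * u ^ α) := by
    intro u hu
    rw [integral_congr_ae (hfac u hu), integral_const_mul]
  have hfint : ∀ᶠ u : ℝ in atTop, Integrable (fun ω => f (u / Y ω)) μ := by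
    filter_upwards [hl.eventually hint, eventually_gt_atTop 0] with u h1 hu
    exact (h1.const_mul (A u)).congr ((hfac u hu).mono fun ω h => h.symm)
  -- step one
  have step1 : (fun u => (μ {ω | X ω * Y ω > u}).toReal) ~[atTop] fun u => ∫ ω, f (u / Y ω) ∂μ := by
    refine isLittleO_iff.2 fun ε hε => ?_
    obtain ⟨V, hV⟩ := eventually_atTop.1 (isLittleO_iff.1 hX hε)
    filter_upwards [hfint, eventually_gt_atTop 0, eventually_ge_atTop (V * σ)] with u hi hu huV
    obtain ⟨p1, p2⟩ := aux_prod μ X Y hXm hYm hindep hYpos u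
    have hfn : ∀ᵐ ω ∂μ, 0 ≤ f (u / Y ω) := by
      filter_upwards [hYpos] with ω hω
      simp only [hf]
      positivity
    simp only [Pi.sub_apply]
    rw [p2, ← integral_sub p1 hi, Real.norm_of_nonneg (integral_nonneg_of_ae hfn), ← integral_const_mul]
    refine norm_integral_le_of_norm_le (hi.const_mul ε) ?_
    filter_upwards [hYpos, hYle, hfn] with ω h1 h2 h3
    have hv : V ≤ u / Y ω := by
      have : V ≤ u / σ := (le_div_iff₀ hσ).2 huV
      exact this.trans (by gcongr)
    have := hV _ hv
    simp only [Pi.sub_apply] at this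
    rwa [show ‖CX * (u / Y ω) ^ γ * Real.exp (-KX * (u / Y ω) ^ α)‖ = f (u / Y ω) from
      Real.norm_of_nonneg h3] at this
  -- step two
  have step2 : (fun u : ℝ => ψ (KX * u ^ α)) ~[atTop] fun u => L * (KX * u ^ α) ^ (-mu) := by
    refine isEquivalent_of_tendsto_one ?_
    have := (hlim.comp hl).div_const L
    rw [div_self hL0.ne'] at this
    refine this.congr' ?_
    filter_upwards [eventually_gt_atTop 0] with u hu
    simp only [Function.comp, Pi.div_apply]
    rw [Real.rpow_neg (by positivity)]
    have : 0 < (KX * u ^ α) ^ mu := by positivity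
    field_simp
    rfl
  have step3 := (IsEquivalent.refl (u := A) (l := atTop)).mul step2
  refine step1.trans (IsEquivalent.congr_left (IsEquivalent.congr_right step3 ?_) ?_)
  · filter_upwards [eventually_gt_atTop 0] with u hu
    simp only [Pi.mul_apply, hA, hL]
    rw [Real.mul_rpow hKX.le (by positivity), Real.mul_rpow hKX.le hα.le, ← Real.rpow_mul hu.le,
      Real.div_rpow (by positivity) hα.le, ← Real.rpow_mul hσ.le,
      show γ - α * mu = γ + α * -mu by ring, Real.rpow_add hu,
      show α * mu + mu - γ = (1 + α) * mu + -γ by ring, Real.rpow_add hσ, Real.rpow_neg hα.le]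
    ring
  · filter_upwards [eventually_gt_atTop 0] with u hu
    exact (hIeq u hu).symm
end

section
/- Let B be a standard Brownian motion. Then the random variable 𝒳 := sup_{s ≥ 0} B(s)/(1 + s) satisfies P(𝒳 > u) = e^{-2u²} for all u > 0, and consequently E[𝒳^α] = 2^{-α/2} Γ(α/2 + 1) for every α > 0. -/
open MeasureTheory ProbabilityTheory Filter

section BW
open scoped NNReal ENNReal Topology


theorem bw_pre {Ω : Type*} [MeasurableSpace Ω] (μ : Measure Ω) [IsProbabilityMeasure μ]
    (B : ℝ → Ω → ℝ) (hBm : ∀ t, Measurable (B t))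
    (hGauss : ∀ (n : ℕ) (t : Fin n → ℝ) (l : Fin n → ℝ), ∃ (m : ℝ) (v : NNReal),
      Measure.map (fun ω => ∑ i, l i * B (t i) ω) μ = gaussianReal m v)
    (hcent : ∀ t ≥ (0:ℝ), ∫ ω, B t ω ∂μ = 0)
    (hcov : ∀ s ≥ (0:ℝ), ∀ t ≥ (0:ℝ), ∫ ω, B s ω * B t ω ∂μ = min s t) :
    IsPreBrownianReal (fun t : ℝ≥0 => B t) μ := by
  have hG : IsGaussianProcess (fun t : ℝ≥0 => B t) μ := by
    refine ⟨fun I => ⟨?_⟩⟩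
    refine isGaussian_of_map_eq_gaussianReal fun L => ?_
    have hm : Measurable (fun ω => I.restrict (fun t : ℝ≥0 => B t ω)) :=
      measurable_pi_lambda _ fun i => hBm _
    obtain ⟨m, v, h⟩ := hGauss I.card (fun i => ((I.equivFin.symm i : ℝ≥0) : ℝ))
      (fun i => L (Pi.single (I.equivFin.symm i) 1))
    refine ⟨m, v, ?_⟩
    rw [Measure.map_map (by fun_prop) hm, ← h]
    congr 1
    ext ω
    simp only [Function.comp]
    rw [I.equivFin.symm.sum_comp (fun i : I => L (Pi.single i 1) * B (i : ℝ≥0) ω)]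
    conv_lhs => rw [← Finset.univ_sum_single (I.restrict (fun t : ℝ≥0 => B t ω))]
    rw [map_sum]
    refine Finset.sum_congr rfl fun i _ => ?_
    rw [mul_comm, ← smul_eq_mul, ← map_smul, ← Pi.single_smul]
    simp
  refine hG.isPreBrownianReal_of_covariance (fun t => hcent t t.2) fun s t hst => ?_
  rw [covariance_eq_sub (hG.hasGaussianLaw_eval s).memLp_two (hG.hasGaussianLaw_eval t).memLp_two]
  have := hcov s s.2 t t.2
  rw [hcent s s.2, zero_mul, sub_zero]
  simp only [Pi.mul_apply]
  rw [this]
  exact min_eq_left hst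

noncomputable def bwM {Ω : Type*} (W : ℝ≥0 → Ω → ℝ) (u : ℝ) (t : ℝ≥0) (ω : Ω) : ℝ :=
  Real.exp (2 * u * W t ω - 2 * u ^ 2 * t)

section
variable {Ω : Type*} [mΩ : MeasurableSpace Ω] {μ : Measure Ω} [IsProbabilityMeasure μ]
  {W : ℝ≥0 → Ω → ℝ}

theorem bwM_meas (hm : ∀ t, Measurable (W t)) (u : ℝ) (t : ℝ≥0) : Measurable (bwM W u t) := by
  unfold bwM
  have := hm t
  fun_prop

theorem bw_exp_incr (hB : IsPreBrownianReal W μ) (a : ℝ) (s d : ℝ≥0) :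
    ∫⁻ ω, ENNReal.ofReal (Real.exp (a * (W (s + d) ω - W s ω))) ∂μ
      = ENNReal.ofReal (Real.exp (a ^ 2 * d / 2)) := by
  have h := hB.hasLaw_sub (s + d) s
  have hd : nndist ((s + d : ℝ≥0) : ℝ) (s : ℝ) = d := by
    ext; simp
  have h2 : μ.map (W (s + d) - W s) = gaussianReal 0 d := by
    have := h.map_eq
    rwa [show nndist (s + d : ℝ≥0).1 s.1 = d from hd] at this
  have h3 := mgf_gaussianReal h2 a
  have hi : Integrable (fun ω => Real.exp (a * (W (s + d) - W s) ω)) μ := by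
    have := integrable_exp_mul_gaussianReal (μ := 0) (v := d) a
    rw [← h2] at this
    exact (integrable_map_measure (by fun_prop) h.aemeasurable).1 this
  rw [mgf] at h3
  have h4 := ofReal_integral_eq_lintegral_ofReal hi (ae_of_all _ fun _ => (Real.exp_pos _).le)
  rw [h3] at h4
  simp only [Pi.sub_apply] at h4
  rw [← h4]
  congr 2
  ring

@[reducible] def bwF {Ω : Type*} (W : ℝ≥0 → Ω → ℝ) (s : ℝ≥0) : MeasurableSpace Ω :=
  MeasurableSpace.comap (fun ω (t : Set.Iic s) => W t ω) inferInstance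

@[reducible] def bwG {Ω : Type*} (W : ℝ≥0 → Ω → ℝ) (s : ℝ≥0) : MeasurableSpace Ω :=
  MeasurableSpace.comap (fun ω (t : ℝ≥0) => W (s + t) ω - W s ω) inferInstance

theorem bwF_le (hm : ∀ t, Measurable (W t)) (s : ℝ≥0) : bwF W s ≤ mΩ :=
  measurable_iff_comap_le.1 (measurable_pi_lambda _ fun _ => hm _)

theorem bwG_le (hm : ∀ t, Measurable (W t)) (s : ℝ≥0) : bwG W s ≤ mΩ :=
  measurable_iff_comap_le.1 (measurable_pi_lambda _ fun _ => (hm _).sub (hm _))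

theorem bwF_meas {Ω : Type*} (W : ℝ≥0 → Ω → ℝ) {r s : ℝ≥0} (h : r ≤ s) :
    Measurable[bwF W s] (W r) := by
  have h2 := comap_measurable (m := inferInstance) (fun ω (t : Set.Iic s) => W t ω)
  exact (measurable_pi_apply (⟨r, h⟩ : Set.Iic s)).comp h2

theorem bwG_meas {Ω : Type*} (W : ℝ≥0 → Ω → ℝ) (s d : ℝ≥0) :
    Measurable[bwG W s] (fun ω => W (s + d) ω - W s ω) := by
  have h2 := comap_measurable (m := inferInstance) (fun ω (t : ℝ≥0) => W (s + t) ω - W s ω)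
  exact (measurable_pi_apply d).comp h2

theorem bwFM_meas {Ω : Type*} (W : ℝ≥0 → Ω → ℝ) (u : ℝ) {r s : ℝ≥0} (h : r ≤ s) :
    Measurable[bwF W s] (bwM W u r) :=
  (by fun_prop : Measurable fun x : ℝ => (Real.exp (2 * u * x - 2 * u ^ 2 * r))).comp
    (bwF_meas W h)

theorem bw_opt (hB : IsPreBrownianReal W μ) (hm : ∀ t, Measurable (W t)) (u : ℝ) {s T : ℝ≥0}
    (hsT : s ≤ T) {H : Set Ω} (hH : MeasurableSet[bwF W s] H) :
    ∫⁻ ω in H, ENNReal.ofReal (bwM W u T ω) ∂μ = ∫⁻ ω in H, ENNReal.ofReal (bwM W u s ω) ∂μ := by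
  obtain ⟨d, rfl⟩ := exists_add_of_le hsT
  have hind : Indep (bwG W s) (bwF W s) μ := hB.indepFun_shift s
  have hHm := bwF_le hm s _ hH
  rw [← lintegral_indicator hHm, ← lintegral_indicator hHm]
  have hf : Measurable[bwG W s]
      (fun ω => ENNReal.ofReal (Real.exp (2 * u * (W (s + d) ω - W s ω)))) :=
    (by fun_prop : Measurable fun x : ℝ => ENNReal.ofReal (Real.exp (2 * u * x))).comp
      (bwG_meas W s d)
  have hg : Measurable[bwF W s] (H.indicator fun ω => ENNReal.ofReal (bwM W u s ω)) :=
    Measurable.indicator (ENNReal.measurable_ofReal.comp (bwFM_meas W u le_rfl)) hH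
  have key := lintegral_mul_eq_lintegral_mul_lintegral_of_independent_measurableSpace
    (bwG_le hm s) (bwF_le hm s) hind hf hg
  rw [bw_exp_incr hB] at key
  have e : ∀ ω, H.indicator (fun ω => ENNReal.ofReal (bwM W u (s + d) ω)) ω
      = ENNReal.ofReal (Real.exp (-(2 * u ^ 2 * d))) * 
      (ENNReal.ofReal (Real.exp (2 * u * (W (s + d) ω - W s ω))) * 
        H.indicator (fun ω => ENNReal.ofReal (bwM W u s ω)) ω) := by
    intro ω
    by_cases h : ω ∈ H
    · simp only [Set.indicator_of_mem h, bwM]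
      rw [← ENNReal.ofReal_mul (Real.exp_pos _).le, ← ENNReal.ofReal_mul (Real.exp_pos _).le,
        ← Real.exp_add, ← Real.exp_add]
      congr 2
      push_cast
      ring
    · simp [h]
  simp_rw [e]
  rw [lintegral_const_mul' _ _ ENNReal.ofReal_ne_top, key, ← mul_assoc, 
    ← ENNReal.ofReal_mul (Real.exp_pos _).le, ← Real.exp_add]
  have : -(2 * u ^ 2 * (d : ℝ)) + (2 * u) ^ 2 * d / 2 = 0 := by ring
  rw [this]
  simp

theorem bw_total (hB : IsPreBrownianReal W μ) (hm : ∀ t, Measurable (W t)) (u : ℝ) (T : ℝ≥0) :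
    ∫⁻ ω, ENNReal.ofReal (bwM W u T ω) ∂μ = 1 := by
  have h := bw_opt hB hm u (zero_le : 0 ≤ T) (H := Set.univ) MeasurableSet.univ
  rw [Measure.restrict_univ] at h
  rw [h]
  have : (fun ω => ENNReal.ofReal (bwM W u 0 ω)) =ᵐ[μ] fun _ => 1 := by
    filter_upwards [hB.eval_zero_ae_eq_zero] with ω h
    simp [bwM, h]
  rw [lintegral_congr_ae this]
  simp

def bwH {Ω : Type*} (W : ℝ≥0 → Ω → ℝ) (u l : ℝ) (t : ℕ → ℝ≥0) (k : ℕ) : Set Ω :=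
  {ω | l ≤ bwM W u (t k) ω ∧ ∀ j < k, bwM W u (t j) ω < l}

theorem bwH_meas {Ω : Type*} (W : ℝ≥0 → Ω → ℝ) (u l : ℝ) {t : ℕ → ℝ≥0} (ht : Monotone t) (k : ℕ) :
    MeasurableSet[bwF W (t k)] (bwH W u l t k) := by
  have h1 : MeasurableSet[bwF W (t k)] {ω | l ≤ bwM W u (t k) ω} :=
    bwFM_meas W u le_rfl measurableSet_Ici
  have h2 : MeasurableSet[bwF W (t k)] (⋂ j, ⋂ (_ : j < k), {ω | bwM W u (t j) ω < l}) :=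
    MeasurableSet.iInter fun j => MeasurableSet.iInter fun hj =>
      bwFM_meas W u (ht hj.le) measurableSet_Iio
  convert MeasurableSet.inter h1 h2 using 1
  ext ω
  simp [bwH]

theorem bwH_disj {Ω : Type*} (W : ℝ≥0 → Ω → ℝ) (u l : ℝ) (t : ℕ → ℝ≥0) {i j : ℕ} (h : i ≠ j) :
    Disjoint (bwH W u l t i) (bwH W u l t j) := by
  rw [Set.disjoint_left]
  rintro ω ⟨h1, h2⟩ ⟨h3, h4⟩
  rcases lt_or_gt_of_ne h with h | h
  · exact absurd (h4 i h) (not_lt.2 h1)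
  · exact absurd (h2 j h) (not_lt.2 h3)

theorem bw_union (hB : IsPreBrownianReal W μ) (hm : ∀ t, Measurable (W t)) (u l : ℝ)
    {t : ℕ → ℝ≥0} {T : ℝ≥0} {N : ℕ} (hT : ∀ k ≤ N, t k ≤ T) (G : ℕ → Set Ω)
    (hG : ∀ k, MeasurableSet[bwF W (t k)] (G k)) (hGH : ∀ k, G k ⊆ bwH W u l t k) :
    ∫⁻ ω in (⋃ k ∈ Finset.range (N + 1), G k), ENNReal.ofReal (bwM W u T ω) ∂μ
      = ∑ k ∈ Finset.range (N + 1), ∫⁻ ω in G k, ENNReal.ofReal (bwM W u (t k) ω) ∂μ := by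
  rw [lintegral_biUnion_finset]
  · refine Finset.sum_congr rfl fun k hk => ?_
    exact bw_opt hB hm u (hT k (by simpa [Nat.lt_succ_iff] using hk)) (hG k)
  · intro i _ j _ hij
    exact (bwH_disj W u l t hij).mono (hGH i) (hGH j)
  · exact fun k _ => bwF_le hm _ _ (hG k)

theorem bw_hit {Ω : Type*} (W : ℝ≥0 → Ω → ℝ) (u l : ℝ) (t : ℕ → ℝ≥0) (N : ℕ) {ω : Ω}
    (h : ∃ k ≤ N, l ≤ bwM W u (t k) ω) : ∃ k ≤ N, ω ∈ bwH W u l t k := by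
  classical
  have h' : ∃ k, k ≤ N ∧ l ≤ bwM W u (t k) ω := by simpa using h
  refine ⟨Nat.find h', (Nat.find_spec h').1, (Nat.find_spec h').2, fun j hj => ?_⟩
  have := Nat.find_min h' hj
  by_contra hc
  exact this ⟨(hj.le.trans (Nat.find_spec h').1), not_lt.1 hc⟩

theorem bw_upper_grid (hB : IsPreBrownianReal W μ) (hm : ∀ t, Measurable (W t)) (u l : ℝ)
    {t : ℕ → ℝ≥0} (ht : Monotone t) (N : ℕ) :
    ENNReal.ofReal l * μ {ω | ∃ k ≤ N, l ≤ bwM W u (t k) ω} ≤ 1 := by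
  have hU := bw_union hB hm u l (t := t) (T := t N) (N := N) (fun k hk => ht hk)
    (bwH W u l t) (bwH_meas W u l ht) (fun k => le_rfl)
  have hsub : {ω | ∃ k ≤ N, l ≤ bwM W u (t k) ω} ⊆ ⋃ k ∈ Finset.range (N + 1), bwH W u l t k := by
    intro ω h
    obtain ⟨k, hk, h⟩ := bw_hit W u l t N h
    simp only [Set.mem_iUnion]
    exact ⟨k, by simpa [Nat.lt_succ_iff] using hk, h⟩
  calc ENNReal.ofReal l * μ {ω | ∃ k ≤ N, l ≤ bwM W u (t k) ω}
      ≤ ENNReal.ofReal l * ∑ k ∈ Finset.range (N + 1), μ (bwH W u l t k) := by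
        gcongr
        exact (measure_mono hsub).trans (measure_biUnion_finset_le _ _)
    _ = ∑ k ∈ Finset.range (N + 1), ENNReal.ofReal l * μ (bwH W u l t k) := by
        rw [Finset.mul_sum]
    _ ≤ ∑ k ∈ Finset.range (N + 1), ∫⁻ ω in bwH W u l t k, ENNReal.ofReal (bwM W u (t k) ω) ∂μ := by
        gcongr with k hk
        rw [← setLIntegral_const]
        refine setLIntegral_mono' (bwF_le hm _ _ (bwH_meas W u l ht k)) fun ω hω => ?_
        exact ENNReal.ofReal_le_ofReal hω.1
    _ ≤ 1 := by
        rw [← hU, ← bw_total hB hm u (t N)]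
        exact setLIntegral_le_lintegral _ _

theorem bwM_cont {Ω : Type*} {W : ℝ≥0 → Ω → ℝ} (hc : ∀ ω, Continuous fun t => W t ω)
    (u : ℝ) (ω : Ω) : Continuous fun t => bwM W u t ω := by
  have := hc ω
  unfold bwM
  fun_prop

theorem bw_upper (hB : IsPreBrownianReal W μ) (hm : ∀ t, Measurable (W t))
    (hc : ∀ ω, Continuous fun t => W t ω) (u l : ℝ) :
    ENNReal.ofReal l * μ {ω | ∃ t, l < bwM W u t ω} ≤ 1 := by
  set A : ℕ → Set Ω := fun n => {ω | ∃ k ≤ n ^ 2, l ≤ bwM W u ((k : ℝ≥0) / n) ω} with hA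
  have hAl : ∀ n, ENNReal.ofReal l * μ (A n) ≤ 1 := fun n =>
    bw_upper_grid hB hm u l (t := fun k => (k : ℝ≥0) / n)
      (fun i j hij => by dsimp only; gcongr) (n ^ 2)
  have hsub : {ω | ∃ t, l < bwM W u t ω} ⊆ ⋃ m : ℕ, ⋂ n : ℕ, ⋂ (_ : m ≤ n), A n := by
    rintro ω ⟨t, ht⟩
    have h1 : Tendsto (fun n : ℕ => ((⌊(t : ℝ) * n⌋₊ : ℝ≥0) / (n : ℝ≥0))) atTop (𝓝 t) := by
      rw [← NNReal.tendsto_coe]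
      have := (tendsto_nat_floor_mul_div_atTop (R := ℝ) t.2).comp tendsto_natCast_atTop_atTop
      refine this.congr fun n => ?_
      simp
    have h2 : Continuous fun t => bwM W u t ω := bwM_cont hc u ω
    have h3 := ((h2.tendsto t).comp h1).eventually (lt_mem_nhds ht)
    obtain ⟨m, hm⟩ := eventually_atTop.1 (h3.and (eventually_ge_atTop ⌈(t : ℝ)⌉₊))
    simp only [Set.mem_iUnion, Set.mem_iInter]
    refine ⟨m, fun n hn => ?_⟩
    obtain ⟨h4, h5⟩ := hm n hn
    refine ⟨⌊(t : ℝ) * n⌋₊, ?_, h4.le⟩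
    have h5 : (t : ℝ) ≤ n := (Nat.le_ceil (t : ℝ)).trans (by exact_mod_cast h5)
    refine Nat.floor_le_of_le ?_
    push_cast
    rw [sq]
    gcongr
  by_cases hl : ENNReal.ofReal l = 0
  · simp [hl]
  have hq : μ {ω | ∃ t, l < bwM W u t ω} ≤ (ENNReal.ofReal l)⁻¹ := by
    refine (measure_mono hsub).trans ?_
    rw [Monotone.measure_iUnion]
    · refine iSup_le fun m => ?_
      refine (measure_mono (Set.iInter₂_subset m le_rfl)).trans ?_
      rw [ENNReal.le_inv_iff_mul_le, mul_comm]
      exact hAl m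
    · intro i j hij
      exact Set.iInter_mono fun n => Set.iInter_mono' fun h => ⟨hij.trans h, le_rfl⟩
  calc _ ≤ ENNReal.ofReal l * (ENNReal.ofReal l)⁻¹ := by gcongr
    _ ≤ 1 := ENNReal.mul_inv_le_one _

/-- lower bound, at fixed horizon -/
theorem bw_lower_fixed (hB : IsPreBrownianReal W μ) (hm : ∀ t, Measurable (W t))
    (h0 : ∀ ω, W 0 ω = 0)
    (hc : ∀ ω, Continuous fun t => W t ω) (u l : ℝ) (hl : 1 < l) (T : ℝ≥0) (δ : ℝ) (hδ : 0 < δ) :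
    1 ≤ ENNReal.ofReal (l + δ) * μ {ω | ∃ t, l ≤ bwM W u t ω}
      + ∫⁻ ω in {ω | bwM W u T ω < l}, ENNReal.ofReal (bwM W u T ω) ∂μ := by
  set t : ℕ → ℕ → ℝ≥0 := fun n k => T * ((k : ℝ≥0) / (n + 1 : ℕ)) with htdef
  have htm : ∀ n, Monotone (t n) := fun n i j hij => by simp only [htdef]; gcongr
  have htN : ∀ n, t n (n + 1) = T := by
    intro n
    simp only [htdef]
    rw [div_self (by positivity), mul_one]
  set G : ℕ → ℕ → Set Ω := fun n k => bwH W u l (t n) k ∩ {ω | bwM W u (t n k) ω ≤ l + δ} with hGdef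
  have hGm : ∀ n k, MeasurableSet[bwF W (t n k)] (G n k) := fun n k =>
    MeasurableSet.inter (bwH_meas W u l (htm n) k) (bwFM_meas W u le_rfl measurableSet_Iic)
  set U : ℕ → Set Ω := fun n => ⋃ k ∈ Finset.range (n + 1 + 1), G n k with hU
  have hUm : ∀ n, MeasurableSet (U n) := fun n =>
    Finset.measurableSet_biUnion _ fun k _ => bwF_le hm _ _ (hGm n k)
  set C : Set Ω := {ω | bwM W u T ω < l} with hC
  have hCm : MeasurableSet C := bwM_meas hm u T measurableSet_Iio
  set f : Ω → ℝ≥0∞ := fun ω => ENNReal.ofReal (bwM W u T ω) with hf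
  have hfm : Measurable f := ENNReal.measurable_ofReal.comp (bwM_meas hm u T)
  have h1 : ∀ n, ∫⁻ ω in U n, f ω ∂μ ≤ ENNReal.ofReal (l + δ) * μ {ω | ∃ t, l ≤ bwM W u t ω} := by
    intro n
    rw [hU, hf, bw_union hB hm u l (t := t n) (T := T) (N := n + 1)
      (fun k hk => (htm n hk).trans (htN n).le) (G n) (hGm n) (fun k => Set.inter_subset_left)]
    calc _ ≤ ∑ k ∈ Finset.range (n + 1 + 1), ENNReal.ofReal (l + δ) * μ (G n k) := by
          gcongr with k hk
          rw [← setLIntegral_const]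
          refine setLIntegral_mono' (bwF_le hm _ _ (hGm n k)) fun ω hω => ?_
          exact ENNReal.ofReal_le_ofReal hω.2
      _ = ENNReal.ofReal (l + δ) * μ (U n) := by
          rw [← Finset.mul_sum, hU, measure_biUnion_finset]
          · intro i _ j _ hij
            exact (bwH_disj W u l (t n) hij).mono Set.inter_subset_left Set.inter_subset_left
          · exact fun k _ => bwF_le hm _ _ (hGm n k)
      _ ≤ _ := by
          gcongr
          intro ω hω
          simp only [hU, Set.mem_iUnion] at hω
          obtain ⟨k, _, hk⟩ := hω
          exact ⟨_, hk.1.1⟩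
  have h2 : ∀ n, 1 ≤ ENNReal.ofReal (l + δ) * μ {ω | ∃ t, l ≤ bwM W u t ω} + ∫⁻ ω in C, f ω ∂μ
      + ∫⁻ ω, (U n ∪ C)ᶜ.indicator f ω ∂μ := by
    intro n
    rw [← bw_total hB hm u T, ← lintegral_add_compl f ((hUm n).union hCm),
      ← lintegral_indicator ((hUm n).union hCm).compl]
    gcongr
    refine (lintegral_union_le _ _ _).trans ?_
    gcongr
    exact h1 n
  have h3 : Tendsto (fun n => ∫⁻ ω, (U n ∪ C)ᶜ.indicator f ω ∂μ) atTop (𝓝 0) := by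
    have : (0 : ℝ≥0∞) = ∫⁻ ω, 0 ∂μ := by simp
    rw [this]
    refine tendsto_lintegral_of_dominated_convergence f 
      (fun n => hfm.indicator ((hUm n).union hCm).compl)
      (fun n => ae_of_all _ fun ω => Set.indicator_le_self _ _ _) ?_ (ae_of_all _ fun ω => ?_)
    · rw [hf, bw_total hB hm u T]; simp
    refine tendsto_const_nhds.congr' ?_
    have hcont := bwM_cont hc u ω
    have huc : UniformContinuousOn (fun t => bwM W u t ω) (Set.Icc 0 T) :=
      isCompact_Icc.uniformContinuousOn_of_continuous hcont.continuousOn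
    obtain ⟨η, hη, hηd⟩ := Metric.uniformContinuousOn_iff.1 huc δ hδ
    obtain ⟨n₀, hn₀⟩ := exists_nat_gt (T / η)
    filter_upwards [eventually_ge_atTop n₀] with n hn
    symm
    rw [Set.indicator_of_notMem]
    rw [Set.notMem_compl_iff]
    by_cases hωC : ω ∈ C
    · exact Or.inr hωC
    left
    have hTl : l ≤ bwM W u T ω := not_lt.1 hωC
    obtain ⟨k, hk, hkH⟩ := bw_hit W u l (t n) (n + 1) (ω := ω) ⟨n + 1, le_rfl, by rwa [htN]⟩
    simp only [hU, Set.mem_iUnion]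
    refine ⟨k, by simpa [Nat.lt_succ_iff] using hk, hkH, ?_⟩
    rcases k with _ | k
    · have := hkH.1
      simp [htdef, bwM, h0] at this
      linarith
    have hlt := hkH.2 k (Nat.lt_succ_self k)
    have hd : dist (t n (k + 1)) (t n k) < η := by
      rw [NNReal.dist_eq]
      simp only [htdef]
      push_cast
      have : (T : ℝ) * ((k + 1) / (n + 1)) - T * (k / (n + 1)) = T / (n + 1) := by
        field_simp; ring
      rw [this, abs_of_nonneg (by positivity), div_lt_iff₀ (by positivity)]
      rw [div_lt_iff₀ hη] at hn₀
      have : (n₀ : ℝ) ≤ n := by exact_mod_cast hn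
      nlinarith
    have := hηd (t n (k + 1)) ⟨zero_le, (htm n hk).trans (htN n).le⟩ (t n k)
      ⟨zero_le, (htm n (by omega)).trans (htN n).le⟩ hd
    rw [Real.dist_eq] at this
    have := (abs_lt.1 this).2
    simp only [Set.mem_ofPred_eq]
    linarith
  have h4 := ge_of_tendsto' (h3.const_add (ENNReal.ofReal (l + δ) * μ {ω | ∃ t, l ≤ bwM W u t ω} 
    + ∫⁻ ω in C, f ω ∂μ)) h2
  rwa [add_zero] at h4

theorem bw_small (hB : IsPreBrownianReal W μ) (hm : ∀ t, Measurable (W t))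
    (u l : ℝ) (hl : 0 < l) (T : ℝ≥0) :
    ∫⁻ ω in {ω | bwM W u T ω < l}, ENNReal.ofReal (bwM W u T ω) ∂μ
      ≤ ENNReal.ofReal (Real.sqrt l * Real.exp (- (u ^ 2 / 2) * T)) := by
  calc _ ≤ ∫⁻ ω in {ω | bwM W u T ω < l}, 
          ENNReal.ofReal (Real.sqrt l * Real.exp (- (u ^ 2 / 2) * T)) *
            ENNReal.ofReal (bwM W (u / 2) T ω) ∂μ := by
        refine setLIntegral_mono' (bwM_meas hm u T measurableSet_Iio) fun ω hω => ?_
        have hω : bwM W u T ω < l := hω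
        rw [← ENNReal.ofReal_mul (by positivity)]
        refine ENNReal.ofReal_le_ofReal ?_
        have h1 : bwM W u T ω = Real.sqrt (bwM W u T ω) * Real.sqrt (bwM W u T ω) :=
          (Real.mul_self_sqrt (Real.exp_pos _).le).symm
        have h2 : Real.sqrt (bwM W u T ω) 
            = Real.exp (- (u ^ 2 / 2) * T) * bwM W (u / 2) T ω := by
          simp only [bwM]
          rw [← Real.exp_half, ← Real.exp_add]
          congr 1
          ring
        have h3 : Real.sqrt (bwM W u T ω) ≤ Real.sqrt l := Real.sqrt_le_sqrt hω.le
        calc bwM W u T ω = Real.sqrt (bwM W u T ω) * Real.sqrt (bwM W u T ω) := h1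
          _ ≤ Real.sqrt l * Real.sqrt (bwM W u T ω) := by gcongr
          _ = _ := by rw [h2]; ring
    _ ≤ ∫⁻ ω, ENNReal.ofReal (Real.sqrt l * Real.exp (- (u ^ 2 / 2) * T)) *
            ENNReal.ofReal (bwM W (u / 2) T ω) ∂μ := setLIntegral_le_lintegral _ _
    _ = _ := by
        rw [lintegral_const_mul' _ _ ENNReal.ofReal_ne_top, bw_total hB hm, mul_one]

theorem bw_lower (hB : IsPreBrownianReal W μ) (hm : ∀ t, Measurable (W t))
    (h0 : ∀ ω, W 0 ω = 0)
    (hc : ∀ ω, Continuous fun t => W t ω) (u l : ℝ) (hu : 0 < u) (hl : 1 < l) :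
    1 ≤ ENNReal.ofReal l * μ {ω | ∃ t, l ≤ bwM W u t ω} := by
  have h1 : ∀ δ > 0, 1 ≤ ENNReal.ofReal (l + δ) * μ {ω | ∃ t, l ≤ bwM W u t ω} := by
    intro δ hδ
    have ht : Tendsto (fun T : ℕ => 
        ENNReal.ofReal (Real.sqrt l * Real.exp (- (u ^ 2 / 2) * (T : ℝ≥0)))) atTop (𝓝 0) := by
      rw [← ENNReal.ofReal_zero]
      refine ENNReal.tendsto_ofReal ?_
      rw [← mul_zero (Real.sqrt l)]
      refine Tendsto.const_mul _ (Real.tendsto_exp_atBot.comp ?_)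
      simp only [NNReal.coe_natCast]
      exact tendsto_natCast_atTop_atTop.const_mul_atTop_of_neg (by nlinarith)
    have h4 := ge_of_tendsto' (ht.const_add 
      (ENNReal.ofReal (l + δ) * μ {ω | ∃ t, l ≤ bwM W u t ω})) fun T =>
        (bw_lower_fixed hB hm h0 hc u l hl T δ hδ).trans 
          (add_le_add_right (bw_small hB hm u l (by linarith) T) _)
    rwa [add_zero] at h4
  have ht : Tendsto (fun δ : ℝ => ENNReal.ofReal (l + δ) * μ {ω | ∃ t, l ≤ bwM W u t ω}) (𝓝[>] 0)
      (𝓝 (ENNReal.ofReal l * μ {ω | ∃ t, l ≤ bwM W u t ω})) := by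
    refine ENNReal.Tendsto.mul_const ?_ (Or.inr (measure_ne_top _ _))
    refine ENNReal.tendsto_ofReal ?_
    have : Tendsto (fun δ : ℝ => l + δ) (𝓝 0) (𝓝 (l + 0)) := tendsto_const_nhds.add tendsto_id
    rw [add_zero] at this
    exact this.mono_left nhdsWithin_le_nhds
  exact ge_of_tendsto ht (eventually_mem_nhdsWithin.mono fun δ hδ => h1 δ hδ)
end

end BW

theorem sup_brownian_over_linear_weibull
    {Ω : Type*} [MeasurableSpace Ω] (μ : Measure Ω) [IsProbabilityMeasure μ]
    (B : ℝ → Ω → ℝ) (hBm : ∀ t, Measurable (B t))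
    (h0 : ∀ ω, B 0 ω = 0)
    (hGauss : ∀ (n : ℕ) (t : Fin n → ℝ) (l : Fin n → ℝ), ∃ (m : ℝ) (v : NNReal),
      Measure.map (fun ω => ∑ i, l i * B (t i) ω) μ = gaussianReal m v)
    (hcent : ∀ t ≥ (0:ℝ), ∫ ω, B t ω ∂μ = 0)
    (hcov : ∀ s ≥ (0:ℝ), ∀ t ≥ (0:ℝ), ∫ ω, B s ω * B t ω ∂μ = min s t)
    (hcont : ∀ ω, ContinuousOn (fun t => B t ω) (Set.Ici 0)) :
    ∀ XX : Ω → ℝ, (∀ ω, XX ω = ⨆ s : {s : ℝ // 0 ≤ s}, B s ω / (1 + s)) →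
      (∀ u > (0:ℝ), (μ {ω | XX ω > u}).toReal = Real.exp (-2 * u ^ 2)) ∧
      (∀ α > (0:ℝ), ∫ ω, XX ω ^ α ∂μ = 2 ^ (-α / 2) * Real.Gamma (α / 2 + 1)) := by
  intro XX hXX
  set W : NNReal → Ω → ℝ := fun t => B t with hWdef
  have hB : IsPreBrownianReal W μ := bw_pre μ B hBm hGauss hcent hcov
  have hm : ∀ t, Measurable (W t) := fun t => hBm t
  have hW0 : ∀ ω, W 0 ω = 0 := fun ω => by simp [hWdef, h0]
  have hc : ∀ ω, Continuous fun t => W t ω := fun ω =>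
    (hcont ω).comp_continuous NNReal.continuous_coe fun t => t.2
  have hX : ∀ ω, XX ω = ⨆ s : NNReal, W s ω / (1 + s) := hXX
  have key1 : ∀ (u : ℝ), 0 < u → ∀ (t : NNReal) ω,
      Real.exp (2 * u ^ 2) < bwM W u t ω ↔ u < W t ω / (1 + t) := by
    intro u hu t ω
    have ht : (0 : ℝ) < 1 + t := by positivity
    rw [bwM, Real.exp_lt_exp, lt_div_iff₀ ht]
    constructor <;> intro h <;> nlinarith
  have key2 : ∀ (u : ℝ), 0 < u → ∀ (t : NNReal) ω,
      Real.exp (2 * u ^ 2) ≤ bwM W u t ω ↔ u ≤ W t ω / (1 + t) := by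
    intro u hu t ω
    have ht : (0 : ℝ) < 1 + t := by positivity
    rw [bwM, Real.exp_le_exp, le_div_iff₀ ht]
    constructor <;> intro h <;> nlinarith
  have up : ∀ u : ℝ, 0 < u →
      μ {ω | ∃ t : NNReal, u < W t ω / (1 + t)} ≤ ENNReal.ofReal (Real.exp (-2 * u ^ 2)) := by
    intro u hu
    have h := bw_upper hB hm hc u (Real.exp (2 * u ^ 2))
    simp_rw [key1 u hu] at h
    rw [mul_comm, ← ENNReal.le_inv_iff_mul_le, ← ENNReal.ofReal_inv_of_pos (Real.exp_pos _),
      ← Real.exp_neg] at h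
    convert h using 3
    ring
  have low : ∀ u : ℝ, 0 < u →
      ENNReal.ofReal (Real.exp (-2 * u ^ 2)) ≤ μ {ω | ∃ t : NNReal, u ≤ W t ω / (1 + t)} := by
    intro u hu
    have h := bw_lower hB hm hW0 hc u (Real.exp (2 * u ^ 2)) hu
      (by rw [Real.one_lt_exp_iff]; positivity)
    simp_rw [key2 u hu] at h
    have e : ENNReal.ofReal (Real.exp (-2 * u ^ 2)) = (ENNReal.ofReal (Real.exp (2 * u ^ 2)))⁻¹ := by
      rw [← ENNReal.ofReal_inv_of_pos (Real.exp_pos _), ← Real.exp_neg]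
      congr 2
      ring
    rw [e]
    have hne : ENNReal.ofReal (Real.exp (2 * u ^ 2)) ≠ 0 := by
      simp [Real.exp_pos]
    calc (ENNReal.ofReal (Real.exp (2 * u ^ 2)))⁻¹
        = (ENNReal.ofReal (Real.exp (2 * u ^ 2)))⁻¹ * 1 := by rw [mul_one]
      _ ≤ (ENNReal.ofReal (Real.exp (2 * u ^ 2)))⁻¹ * (_ * _) := by gcongr
      _ = _ := by rw [← mul_assoc, ENNReal.inv_mul_cancel hne ENNReal.ofReal_ne_top, one_mul]
  have explim : Tendsto (fun n : ℕ => ENNReal.ofReal (Real.exp (-2 * ((n : ℝ) + 1) ^ 2))) atTop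
      (nhds 0) := by
    rw [← ENNReal.ofReal_zero]
    refine ENNReal.tendsto_ofReal (Real.tendsto_exp_atBot.comp ?_)
    refine Tendsto.const_mul_atTop_of_neg (by norm_num) ?_
    refine (tendsto_pow_atTop (by norm_num)).comp ?_
    exact tendsto_atTop_add_const_right _ _ tendsto_natCast_atTop_atTop
  have hunb : μ {ω | ¬ BddAbove (Set.range fun s : NNReal => W s ω / (1 + s))} = 0 := by
    refine le_antisymm (ge_of_tendsto' explim fun n => ?_) (zero_le)
    refine le_trans (measure_mono ?_) (up ((n : ℝ) + 1) (by positivity))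
    intro ω hω
    obtain ⟨_, ⟨t, rfl⟩, ht⟩ := not_bddAbove_iff.1 hω ((n : ℝ) + 1)
    exact ⟨t, ht⟩
  have hXle : ∀ u : ℝ, 0 < u → μ {ω | XX ω > u} ≤ ENNReal.ofReal (Real.exp (-2 * u ^ 2)) := by
    intro u hu
    refine le_trans (measure_mono ?_) (up u hu)
    intro ω hω
    have hω : u < XX ω := hω
    rw [hX] at hω
    exact exists_lt_of_lt_ciSup hω
  have hXge : ∀ u : ℝ, 0 < u → ENNReal.ofReal (Real.exp (-2 * u ^ 2)) ≤ μ {ω | u ≤ XX ω} := by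
    intro u hu
    refine (low u hu).trans ?_
    calc _ ≤ μ ({ω | u ≤ XX ω} ∪
          {ω | ¬ BddAbove (Set.range fun s : NNReal => W s ω / (1 + s))}) := by
          refine measure_mono ?_
          rintro ω ⟨t, ht⟩
          by_cases hb : BddAbove (Set.range fun s : NNReal => W s ω / (1 + s))
          · left
            change u ≤ XX ω
            rw [hX]
            exact ht.trans (le_ciSup hb t)
          · right; exact hb
      _ ≤ _ := measure_union_le _ _
      _ = _ := by rw [hunb, add_zero]
  have hXeq : ∀ u : ℝ, 0 < u → μ {ω | XX ω > u} = ENNReal.ofReal (Real.exp (-2 * u ^ 2)) := by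
    intro u hu
    refine le_antisymm (hXle u hu) ?_
    have ht : Tendsto (fun v : ℝ => ENNReal.ofReal (Real.exp (-2 * v ^ 2))) (nhdsWithin u (Set.Ioi u))
        (nhds (ENNReal.ofReal (Real.exp (-2 * u ^ 2)))) := by
      have : Continuous (fun v : ℝ => ENNReal.ofReal (Real.exp (-2 * v ^ 2))) := 
        ENNReal.continuous_ofReal.comp (by fun_prop)
      exact (this.tendsto u).mono_left nhdsWithin_le_nhds
    refine le_of_tendsto ht (eventually_mem_nhdsWithin.mono fun v hv => ?_)
    have hv : u < v := hv
    refine (hXge v (hu.trans hv)).trans (measure_mono fun ω hω => ?_)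
    exact lt_of_lt_of_le hv hω
  refine ⟨fun u hu => ?_, fun α hα => ?_⟩
  · rw [hXeq u hu, ENNReal.toReal_ofReal (Real.exp_pos _).le]
  have hXnn : ∀ ω, 0 ≤ XX ω := by
    intro ω
    rw [hX]
    by_cases hb : BddAbove (Set.range fun s : NNReal => W s ω / (1 + s))
    · refine le_trans ?_ (le_ciSup hb 0)
      simp [hW0]
    · rw [Real.iSup_of_not_bddAbove hb]
  have hXm : Measurable XX := by
    obtain ⟨S, hSc, hSd⟩ := TopologicalSpace.exists_countable_dense NNReal
    have : Countable S := hSc.to_subtype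
    have e : XX = fun ω => ⨆ s : S, W s ω / (1 + (s : NNReal)) := by
      ext ω
      rw [hX]
      refine (hSd.ciSup' (f := fun s : NNReal => W s ω / (1 + s)) ?_).symm
      have := hc ω
      refine this.div (by fun_prop) fun s => ?_
      positivity
    rw [e]
    exact Measurable.iSup fun s => (hm s).div_const _
  have hL := lintegral_rpow_eq_lintegral_meas_lt_mul μ (ae_of_all _ hXnn) hXm.aemeasurable hα
  have hI := integral_rpow_mul_exp_neg_mul_rpow (p := 2) (q := α - 1) (b := 2) (by norm_num)
    (by linarith) (by norm_num)
  have hInt : IntegrableOn (fun x : ℝ => x ^ (α - 1) * Real.exp (-2 * x ^ (2 : ℝ))) (Set.Ioi 0) :=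
    integrableOn_rpow_mul_exp_neg_mul_rpow (by linarith) (by norm_num) (by norm_num)
  have hJ : ∫⁻ t in Set.Ioi (0 : ℝ), μ {a : Ω | t < XX a} * ENNReal.ofReal (t ^ (α - 1))
      = ENNReal.ofReal (∫ x in Set.Ioi (0 : ℝ), x ^ (α - 1) * Real.exp (-2 * x ^ (2 : ℝ))) := by
    rw [ofReal_integral_eq_lintegral_ofReal hInt]
    · refine setLIntegral_congr_fun measurableSet_Ioi fun t ht => ?_
      have ht : 0 < t := ht
      have := hXeq t ht
      simp only [gt_iff_lt] at this
      simp only [this]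
      rw [← ENNReal.ofReal_mul (Real.exp_pos _).le, mul_comm, Real.rpow_two]
    · refine (ae_restrict_mem measurableSet_Ioi).mono fun t ht => ?_
      have ht : 0 < t := ht
      change 0 ≤ t ^ (α - 1) * Real.exp (-2 * t ^ (2 : ℝ))
      positivity
  rw [integral_eq_lintegral_of_nonneg_ae (ae_of_all _ fun ω => Real.rpow_nonneg (hXnn ω) _)
    (hXm.pow_const α).aestronglyMeasurable, hL, hJ, hI, ← ENNReal.ofReal_mul hα.le,
    ENNReal.toReal_ofReal]
  · rw [Real.Gamma_add_one (by positivity), show α - 1 + 1 = α by ring]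
    ring
  · rw [show α - 1 + 1 = α by ring]
    have := Real.Gamma_pos_of_pos (show 0 < α / 2 by positivity)
    positivity
end
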